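/- arXiv:math/0409169 — 4 statements merged into one kernel-verified Lean document; each statement's English description precedes it below -/
import Mathlib

section
/- Let A be a unital C*-algebra with real rank zero, let q₀, q₁, …, qₙ ∈ A be projections, and let ε > 0. Then there exists a projection e ∈ A such that: (1) q₀ ≤ e; (2) ‖e qₖ − qₖ‖ < ε for 1 ≤ k ≤ n; (3) e is Murray–von Neumann subequivalent to q₀ ⊕ q₁ ⊕ ⋯ ⊕ qₙ in M_{n+1}(A), i.e. there exists s ∈ M_{n+1}(A) with s*s equal to the diagonal matrix diag(e, 0, …, 0) and s s* ≤ diag(q₀, q₁, …, qₙ). -/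
/-- A projection in a C*-algebra: a self-adjoint idempotent. -/
def IsProjection {A : Type*} [Mul A] [Star A] (p : A) : Prop :=
  star p = p ∧ p * p = p

/-- A unital C*-algebra has real rank zero if the invertible self-adjoint elements are dense
in the self-adjoint elements. -/
def RealRankZero (A : Type*) [NormedRing A] [StarRing A] : Prop :=
  ∀ a : A, IsSelfAdjoint a → ∀ ε : ℝ, 0 < ε →
    ∃ b : A, IsSelfAdjoint b ∧ IsUnit b ∧ ‖a - b‖ < ε

section ApproximateSupremum

variable {A : Type*} [CStarAlgebra A]

/-- Corners of a C*-algebra of real rank zero have real rank zero. -/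
theorem RealRankZero.exists_corner_approx (hA : RealRankZero A) {q a : A}
    (hq : IsStarProjection q) (ha : IsSelfAdjoint a) (hqa : q * a = a) {ε : ℝ} (hε : 0 < ε) :
    ∃ h : A, IsSelfAdjoint h ∧ q * h = h ∧ IsUnit (h + (1 - q)) ∧ ‖a - h‖ < ε := by
  have haq : a * q = a := by simpa [ha.star_eq, hq.isSelfAdjoint.star_eq] using congr(star $hqa)
  set r := 1 - q with hr
  have hrp : IsStarProjection r := hq.one_sub
  have hqq : q * q = q := hq.isIdempotentElem
  have hrr : r * r = r := hrp.isIdempotentElem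
  have hqs : star q = q := hq.isSelfAdjoint
  have hrs : star r = r := hrp.isSelfAdjoint
  have hqr : q * r = 0 := hq.mul_one_sub_self
  have hrq : r * q = 0 := hq.one_sub_mul_self
  have hqn : ‖q‖ ≤ 1 := hq.norm_le
  have hrn : ‖r‖ ≤ 1 := hrp.norm_le
  have har : a * r = 0 := by rw [← haq, mul_assoc, hqr, mul_zero]
  have hra : r * a = 0 := by rw [← hqa, ← mul_assoc, hrq, zero_mul]
  set δ := min (1 / 2) (ε / 2) with hδ
  have hδ0 : 0 < δ := by positivity
  have hδ1 : δ ≤ 1 / 2 := min_le_left _ _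
  have hδ2 : δ ≤ ε / 2 := min_le_right _ _
  obtain ⟨b, hb, hbu, hbn⟩ := hA (a + r) (ha.add hrp.isSelfAdjoint) δ hδ0
  set d := b - (a + r) with hd
  have hbd : b = a + r + d := by rw [hd]; abel
  have hdn : ‖d‖ < δ := by rwa [hd, norm_sub_rev]
  have hcut : ∀ s t : A, ‖s‖ ≤ 1 → ‖t‖ ≤ 1 → ‖s * d * t‖ ≤ δ := fun s t hs ht ↦ by
    calc ‖s * d * t‖ ≤ ‖s‖ * ‖d‖ * ‖t‖ := norm_mul₃_le
      _ ≤ 1 * ‖d‖ * 1 := by gcongr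
      _ ≤ δ := by linarith
  have hy0 : q + r * b * r = 1 - -(r * d * r) := by
    rw [hbd]
    simp only [mul_add, add_mul, hra, hrr, zero_add]
    rw [hr]; abel
  obtain ⟨y, hy⟩ : IsUnit (q + r * b * r) := by
    rw [hy0]
    refine isUnit_one_sub_of_norm_lt_one ?_
    rw [norm_neg]
    linarith [hcut r r hrn hrn]
  set z : A := ↑y⁻¹ with hz
  have hzy : z * (q + r * b * r) = 1 := by rw [← hy]; exact y.inv_mul
  have hyz : (q + r * b * r) * z = 1 := by rw [← hy]; exact y.mul_inv
  have hzs : star z = z := by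
    refine left_inv_eq_right_inv (a := q + r * b * r) ?_ hyz
    simpa [hqs, hrs, hb.star_eq, mul_assoc] using congr(star $hyz)
  have hzn : ‖z‖ ≤ 2 := by
    have h1 : z = 1 - r * d * r * z := by
      have : (1 - -(r * d * r)) * z = 1 := by rw [← hy0, hyz]
      rw [sub_neg_eq_add, add_mul, one_mul] at this
      exact eq_sub_of_add_eq this
    have h2 : ‖z‖ ≤ ‖(1 : A)‖ + ‖r * d * r‖ * ‖z‖ := by
      conv_lhs => rw [h1]
      exact (norm_sub_le _ _).trans (by gcongr; exact norm_mul_le _ _)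
    have h3 : ‖(1 : A)‖ ≤ 1 := IsStarProjection.norm_le _ (IsStarProjection.one A)
    have h4 := hcut r r hrn hrn
    nlinarith [norm_nonneg z]
  have hzr : z * (r * b * r) = r := by
    have : z * (q + r * b * r) * r = r := by rw [hzy, one_mul]
    rwa [mul_assoc, add_mul, hqr, zero_add, mul_assoc (r * b), hrr] at this
  set h := b - b * r * z * r * b with hh
  have hhs : IsSelfAdjoint h := by
    rw [IsSelfAdjoint, hh]
    simp [hrs, hb.star_eq, hzs, mul_assoc]
  have hhr : h * r = 0 := by
    have : b * r * z * r * b * r = b * r * (z * (r * b * r)) := by simp only [mul_assoc]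
    rw [hh, sub_mul, this, hzr, mul_assoc, hrr, sub_self]
  have hrh : r * h = 0 := by simpa [hhs.star_eq, hrs] using congr(star $hhr)
  have hqh : q * h = h := by rw [hr, sub_mul, one_mul, sub_eq_zero] at hrh; exact hrh.symm
  have hhq : h * q = h := by rw [hr, mul_sub, mul_one, sub_eq_zero] at hhr; exact hhr.symm
  refine ⟨h, hhs, hqh, ?_, ?_⟩
  · obtain ⟨w, rfl⟩ := hbu
    set c : A := ↑w⁻¹ with hc
    have hwc : (w : A) * c = 1 := w.mul_inv
    have hcs : star c = c := by
      refine left_inv_eq_right_inv (a := (w : A)) ?_ hwc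
      simpa [hb.star_eq] using congr(star $hwc)
    have h1 : h * c * q = q := by
      rw [hh, sub_mul, sub_mul, hwc, one_mul, mul_assoc _ (w : A), hwc, mul_one, mul_assoc _ r, hrq,
        mul_zero, sub_zero]
    have h2 : q * c * h = q := by
      simpa [hhs.star_eq, hcs, hqs, mul_assoc] using congr(star $h1)
    have e1 : (h + r) * (q * c * q + r) = 1 := by
      have : (h + r) * (q * c * q + r) = h * q * c * q + h * r + r * q * c * q + r * r := by
        noncomm_ring
      rw [this, hhq, h1, hhr, hrq, hrr, hr]; simp
    have e2 : (q * c * q + r) * (h + r) = 1 := by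
      have : (q * c * q + r) * (h + r) = q * c * (q * h) + q * c * (q * r) + r * h + r * r := by
        noncomm_ring
      rw [this, hqh, h2, hrh, hqr, hrr, hr]; simp
    exact ⟨⟨_, _, e1, e2⟩, rfl⟩
  · have hqbr : q * b * r = q * d * r := by
      rw [hbd]; simp [mul_add, add_mul, hqa, har, hqr]
    have hrbq : r * b * q = r * d * q := by
      rw [hbd]; simp [mul_add, add_mul, mul_assoc, hra, hrq]
    have hqbq : q * b * q = a + q * d * q := by
      rw [hbd]; simp [mul_add, add_mul, mul_assoc, hqa, haq, hrq]
    have e : h - a = q * d * q - (q * d * r) * z * (r * d * q) := by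
      have : h = q * b * q - (q * b * (r * r)) * z * (r * r) * b * q := by
        conv_lhs => rw [← hhq, ← hqh, hh]
        rw [hrr]
        noncomm_ring
      rw [this, hqbq]
      have : q * b * (r * r) * z * (r * r) * b * q = (q * b * r) * (r * z * r) * (r * b * q) := by
        simp only [mul_assoc]
      rw [this, hqbr, hrbq]
      have : (q * d * r) * (r * z * r) * (r * d * q) = q * d * (r * r) * z * (r * r) * d * q := by
        simp only [mul_assoc]
      rw [this, hrr]
      noncomm_ring
    rw [norm_sub_rev, e]
    have h1 := hcut q q hqn hqn
    have h2 := hcut q r hqn hrn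
    have h3 := hcut r q hrn hqn
    calc _ ≤ ‖q * d * q‖ + ‖q * d * r‖ * ‖z‖ * ‖r * d * q‖ :=
          (norm_sub_le _ _).trans (by gcongr; exact norm_mul₃_le)
      _ ≤ ‖q * d * q‖ + δ * 2 * (1 / 2) := by gcongr; exact h3.trans hδ1
      _ < ε := by
        have : ‖q * d * q‖ < δ := by
          calc ‖q * d * q‖ ≤ ‖q‖ * ‖d‖ * ‖q‖ := norm_mul₃_le
            _ ≤ 1 * ‖d‖ * 1 := by gcongr
            _ < δ := by linarith
        linarith

variable [PartialOrder A] [StarOrderedRing A]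

/-- An invertible self-adjoint element has a positive spectral projection. -/
theorem IsSelfAdjoint.exists_spectral_projection {k : A} (hk : IsSelfAdjoint k) (hu : IsUnit k) :
    ∃ p : A, IsStarProjection p ∧ (∀ x, Commute k x → Commute p x) ∧ 0 ≤ p * k ∧
      (1 - p) * k ≤ 0 := by
  let χ : ℝ → ℝ := fun x ↦ if 0 < x then 1 else 0
  have h0 : ∀ x ∈ spectrum ℝ k, x ≠ 0 := fun x hx h ↦
    spectrum.zero_notMem ℝ hu (h ▸ hx)
  have hχ : ContinuousOn χ (spectrum ℝ k) := by
    intro x hx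
    refine ContinuousAt.continuousWithinAt ?_
    rcases (h0 x hx).lt_or_gt with h | h
    · refine (continuousAt_const (y := (0 : ℝ))).congr ?_
      filter_upwards [gt_mem_nhds h] with y hy
      simp [χ, hy.le]
    · refine (continuousAt_const (y := (1 : ℝ))).congr ?_
      filter_upwards [lt_mem_nhds h] with y hy
      simp [χ, hy]
  have hpk : cfc χ k * k = cfc (fun x ↦ χ x * x) k := by
    rw [cfc_mul χ (fun x ↦ x) k hχ continuousOn_id, cfc_id' ℝ k]
  refine ⟨cfc χ k, ⟨?_, cfc_predicate χ k⟩, fun x hx ↦ hx.cfc_real χ, ?_, ?_⟩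
  · rw [IsIdempotentElem, ← cfc_mul χ χ k hχ hχ]
    congr 1
    ext x
    by_cases h : 0 < x <;> simp [χ, h]
  · rw [hpk]
    refine cfc_nonneg fun x _ ↦ ?_
    by_cases h : 0 < x <;> simp [χ, h, le_of_lt]
  · rw [sub_mul, one_mul, hpk, sub_nonpos]
    nth_rw 1 [← cfc_id' ℝ k]
    refine cfc_mono (fun x _ ↦ ?_) continuousOn_id (hχ.mul continuousOn_id)
    by_cases h : 0 < x
    · simp [χ, h]
    · simpa [χ, h] using not_lt.mp h

/-- In real rank zero, a self-adjoint element of the corner at `q` admits an approximate spectral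
projection for the interval above a small positive number. -/
theorem RealRankZero.exists_approx_spectral_projection (hA : RealRankZero A) {q b : A}
    (hq : IsStarProjection q) (hb : IsSelfAdjoint b) (hqb : q * b = b) {η : ℝ} (hη : 0 < η) :
    ∃ g : A, IsStarProjection g ∧ q * g = g ∧ η • g ≤ g * b * g ∧
      (q - g) * b * (q - g) ≤ (3 * η) • (q - g) := by
  have hqq : q * q = q := hq.isIdempotentElem
  have hqs : star q = q := hq.isSelfAdjoint
  obtain ⟨h, hhs, hqh, hu, hn⟩ := hA.exists_corner_approx hq (a := b - (2 * η) • q)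
    (hb.sub ((IsSelfAdjoint.all (2 * η)).smul hq.isSelfAdjoint))
    (by rw [mul_sub, hqb, mul_smul_comm, hqq]) hη
  have hhq : h * q = h := by simpa [hhs.star_eq, hqs] using congr(star $hqh)
  set k := h + (1 - q) with hk
  obtain ⟨p, hp, hpc, hp1, hp2⟩ :=
    (hhs.add hq.one_sub.isSelfAdjoint).exists_spectral_projection hu
  have hkq : k * q = h := by rw [hk, add_mul, hhq, sub_mul, one_mul, hqq, sub_self, add_zero]
  have hqk : q * k = h := by rw [hk, mul_add, hqh, mul_sub, mul_one, hqq, sub_self, add_zero]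
  have hpp : p * p = p := hp.isIdempotentElem
  have hpq : p * q = q * p := hpc q (hkq.trans hqk.symm)
  have hkh : Commute k (k * q) := (Commute.refl k).mul_right (hkq.trans hqk.symm)
  have hph : p * h = h * p := hpc h (by rwa [hkq] at hkh)
  have hgs : IsStarProjection (q * p) := by
    refine ⟨?_, ?_⟩
    · rw [IsIdempotentElem, mul_assoc, ← mul_assoc p, hpq, mul_assoc q p, hpp, ← mul_assoc, hqq]
    · rw [IsSelfAdjoint, star_mul, hqs, hp.isSelfAdjoint.star_eq, hpq]
  have hqg : q * (q * p) = q * p := by rw [← mul_assoc, hqq]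
  have hgq : q * p * q = q * p := by rw [mul_assoc, hpq, hqg]
  have hfs : IsStarProjection (q - q * p) := by
    refine ⟨?_, hq.isSelfAdjoint.sub hgs.isSelfAdjoint⟩
    rw [IsIdempotentElem, mul_sub, sub_mul, sub_mul, hqq, hqg, hgq, hgs.isIdempotentElem.eq]
    simp
  set d := b - (2 * η) • q - h with hd
  have hds : IsSelfAdjoint d :=
    (hb.sub ((IsSelfAdjoint.all (2 * η)).smul hq.isSelfAdjoint)).sub hhs
  have hbd : b = h + (2 * η) • q + d := by rw [hd]; abel
  have hd1 : d ≤ η • 1 := hds.le_algebraMap_norm_self.trans (by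
    rw [Algebra.algebraMap_eq_smul_one]; exact smul_le_smul_of_nonneg_right hn.le zero_le_one)
  have hd2 : -(η • 1) ≤ d := le_trans (by
    rw [Algebra.algebraMap_eq_smul_one]
    exact neg_le_neg (smul_le_smul_of_nonneg_right hn.le zero_le_one))
    hds.neg_algebraMap_norm_le_self
  have hcut : ∀ f : A, IsStarProjection f → f * q = f →
      f * b * f = f * h * f + (2 * η) • f + f * d * f := by
    intro f hf hfq
    rw [hbd]
    simp only [mul_add, add_mul, mul_smul_comm, smul_mul_assoc, hfq, hf.isIdempotentElem.eq]
  have hcomm : ∀ p' : A, p' * p' = p' → p' * q = q * p' → p' * h = h * p' →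
      (q * p') * h * (q * p') = q * (p' * k) * q := by
    intro p' hpp' hpq' hph'
    rw [mul_assoc q (p' * k), mul_assoc p' k, hkq, mul_assoc q p' h, hph', mul_assoc q,
      mul_assoc h, ← mul_assoc p', hpq', mul_assoc q, hpp', ← mul_assoc h, hhq]
  refine ⟨q * p, hgs, hqg, ?_, ?_⟩
  · have h1 := hgs.isSelfAdjoint.conjugate_le_conjugate hd2
    have h2 : 0 ≤ (q * p) * h * (q * p) := by
      have := hq.isSelfAdjoint.conjugate_nonneg hp1
      rwa [← hcomm p hpp hpq hph] at this
    have h3 : q * p * -(η • 1) * (q * p) = -(η • (q * p)) := by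
      simp [hgs.isIdempotentElem.eq]
    rw [hcut _ hgs hgq, two_mul, add_smul]
    rw [h3] at h1
    calc η • (q * p) = 0 + (η • (q * p) + η • (q * p)) + -(η • (q * p)) := by abel
      _ ≤ _ := by gcongr
  · have h1 := hfs.isSelfAdjoint.conjugate_le_conjugate hd1
    have h2 : (q - q * p) * h * (q - q * p) ≤ 0 := by
      have := hq.isSelfAdjoint.conjugate_nonneg (neg_nonneg.mpr hp2)
      rw [mul_neg, neg_mul, ← hcomm (1 - p) hp.one_sub.isIdempotentElem
        (by rw [sub_mul, mul_sub, hpq, one_mul, mul_one])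
        (by rw [sub_mul, mul_sub, hph, one_mul, mul_one]), mul_sub, mul_one] at this
      exact neg_nonneg.mp this
    have h3 : (q - q * p) * (η • 1) * (q - q * p) = η • (q - q * p) := by
      simp [hfs.isIdempotentElem.eq]
    rw [hcut _ hfs (by rw [sub_mul, hqq, hgq])]
    rw [h3] at h1
    calc _ ≤ 0 + (2 * η) • (q - q * p) + η • (q - q * p) := by gcongr
      _ = _ := by module

/-- Polar decomposition of an element that is bounded below on a projection. -/
theorem exists_polar_decomposition {g z : A} (hg : IsStarProjection g) (hzg : z * g = z) {η : ℝ}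
    (hη : 0 < η) (hz : η • g ≤ star z * z) :
    ∃ m : A, star (z * m) * (z * m) = g ∧ z * m * g = z * m ∧ z * m * star (z * m) * z = z := by
  have hgg : g * g = g := hg.isIdempotentElem
  have hgs : star g = g := hg.isSelfAdjoint
  have hgz : g * star z = star z := by simpa [hgs] using congr(star $hzg)
  set w := star z * z + (1 - g) with hw
  have hwp : IsStrictlyPositive w := by
    have h1 : IsStrictlyPositive (min η 1 • (1 : A)) :=
      IsStrictlyPositive.smul (lt_min hη one_pos) (by cfc_tac)
    refine h1.of_le ?_
    calc min η 1 • (1 : A) = min η 1 • g + min η 1 • (1 - g) := by rw [← smul_add]; simp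
      _ ≤ η • g + (1 : ℝ) • (1 - g) := by
        gcongr
        · exact hg.nonneg
        · exact min_le_left _ _
        · exact hg.one_sub_nonneg
        · exact min_le_right _ _
      _ ≤ w := by rw [one_smul]; exact add_le_add hz le_rfl
  have hwg : w * g = star z * z := by
    rw [hw, add_mul, mul_assoc, hzg, sub_mul, one_mul, hgg, sub_self, add_zero]
  have hgw : g * w = star z * z := by
    rw [hw, mul_add, ← mul_assoc, hgz, mul_sub, mul_one, hgg, sub_self, add_zero]
  set m := w ^ (-(1 / 2) : ℝ) with hm
  have hms : star m = m := (IsSelfAdjoint.of_nonneg CFC.rpow_nonneg).star_eq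
  have hmwm : m * w * m = 1 := CFC.conjugate_rpow_neg_one_half w
  have hmg : m * g = g * m := (show Commute w g from hwg.trans hgw.symm).cfc_nnreal _
  have hmw : m * w = w * m := (Commute.refl w).cfc_nnreal _
  have hmmw : m * (m * w) = 1 := by rw [hmw, ← mul_assoc, hmwm]
  refine ⟨m, ?_, ?_, ?_⟩
  · rw [star_mul, hms, mul_assoc, ← mul_assoc (star z), ← hgw, mul_assoc, ← mul_assoc, hmg,
      mul_assoc, ← mul_assoc, mul_assoc g, ← mul_assoc m, hmwm, mul_one]
  · rw [mul_assoc, hmg, ← mul_assoc, hzg]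
  · rw [star_mul, hms]
    calc z * m * (m * star z) * z = z * m * m * (star z * z) := by simp only [mul_assoc]
      _ = z * (m * (m * w)) * g := by rw [← hwg]; simp only [mul_assoc]
      _ = z := by rw [hmmw, mul_one, hzg]

/-- Two projections have an approximate supremum of the form `p + star v * v`. -/
theorem RealRankZero.exists_partial_isometry (hA : RealRankZero A) {p q : A}
    (hp : IsStarProjection p) (hq : IsStarProjection q) {ε : ℝ} (hε : 0 < ε) :
    ∃ v : A, q * v = v ∧ v * p = 0 ∧ v * star v * v = v ∧
      ‖(1 - star v * v) * ((1 - p) * q)‖ < ε := by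
  have hqq : q * q = q := hq.isIdempotentElem
  have hqs : star q = q := hq.isSelfAdjoint
  set x := (1 - p) * q with hx
  have hxq : x * q = x := by rw [hx, mul_assoc, hqq]
  have hqx : q * star x = star x := by simpa [hqs] using congr(star $hxq)
  have hpx : p * x = 0 := by rw [hx, ← mul_assoc, hp.mul_one_sub_self, zero_mul]
  have hη : 0 < ε ^ 2 / 4 := by positivity
  obtain ⟨g, hg, hqg, hg1, hg2⟩ := hA.exists_approx_spectral_projection hq
    (IsSelfAdjoint.star_mul_self x) (by rw [← mul_assoc, hqx]) hη
  have hgg : g * g = g := hg.isIdempotentElem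
  have hgs : star g = g := hg.isSelfAdjoint
  obtain ⟨m, hm1, hm2, hm3⟩ := exists_polar_decomposition hg (z := x * g)
    (by rw [mul_assoc, hgg]) hη (by simpa [hgs, mul_assoc] using hg1)
  set u := x * g * m with hu
  have hgu : g * star u = star u := by simpa [hgs] using congr(star $hm2)
  have hpu : p * u = 0 := by rw [hu, ← mul_assoc, ← mul_assoc, hpx, zero_mul, zero_mul]
  have hvv : star u * u * star u = star u := by rw [hm1, hgu]
  have huu : IsStarProjection (u * star u) :=
    ⟨by rw [IsIdempotentElem, mul_assoc, ← mul_assoc (star u), hvv], IsSelfAdjoint.mul_star_self u⟩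
  refine ⟨star u, by rw [← hgu, ← mul_assoc, hqg],
    by simpa [hp.isSelfAdjoint.star_eq] using congr(star $hpu), by rw [star_star, hvv], ?_⟩
  have hfs : IsSelfAdjoint (q - g) := hq.isSelfAdjoint.sub hg.isSelfAdjoint
  have e : (1 - u * star u) * x = (1 - u * star u) * (x * (q - g)) := by
    rw [mul_sub x, hxq, mul_sub _ x, sub_mul 1 _ (x * g), hm3, one_mul, sub_self, sub_zero]
  have h1 : ‖x * (q - g)‖ ^ 2 ≤ 3 * (ε ^ 2 / 4) := by
    have hqgn : ‖q - g‖ ≤ 1 := by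
      refine IsStarProjection.norm_le _ ⟨?_, hfs⟩
      have hgq : g * q = g := by simpa [hgs, hqs] using congr(star $hqg)
      rw [IsIdempotentElem, mul_sub, sub_mul, sub_mul, hqq, hqg, hgq, hgg]
      simp
    have e2 : star (x * (q - g)) * (x * (q - g)) = (q - g) * (star x * x) * (q - g) := by
      rw [star_mul, hfs.star_eq]; simp only [mul_assoc]
    rw [sq, ← CStarRing.norm_star_mul_self, e2]
    refine (CStarAlgebra.norm_le_norm_of_nonneg_of_le
      (hfs.conjugate_nonneg (star_mul_self_nonneg x)) hg2).trans ?_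
    rw [norm_smul, Real.norm_of_nonneg (by positivity)]
    exact mul_le_of_le_one_right (by positivity) hqgn
  rw [star_star, e]
  calc _ ≤ ‖1 - u * star u‖ * ‖x * (q - g)‖ := norm_mul_le _ _
    _ ≤ 1 * ‖x * (q - g)‖ := by gcongr; exact huu.one_sub.norm_le
    _ < ε := by
      rw [one_mul]
      refine lt_of_pow_lt_pow_left₀ 2 hε.le (h1.trans_lt ?_)
      linarith [pow_pos hε 2]

/-- A finite family of projections has an approximate supremum which is an orthogonal sum of
projections, the `i`-th of which is equivalent through `v i` to a subprojection of the `i`-th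
member of the family. -/
theorem RealRankZero.exists_orthogonal_partial_isometries (hA : RealRankZero A) (n : ℕ)
    (q : Fin (n + 1) → A) (hq : ∀ k, IsStarProjection (q k)) {ε : ℝ} (hε : 0 < ε) :
    ∃ v : Fin (n + 1) → A, (∀ i, q i * v i = v i) ∧ (∀ i, v i * star (v i) * v i = v i) ∧
      (∀ i j, i ≠ j → v i * star (v j) = 0) ∧
      IsStarProjection (∑ i, star (v i) * v i) ∧ (∀ i, v i * ∑ j, star (v j) * v j = v i) ∧
      q 0 ≤ ∑ i, star (v i) * v i ∧ ∀ k, ‖(1 - ∑ i, star (v i) * v i) * q k‖ < ε := by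
  induction n with
  | zero =>
    have h0 := hq 0
    refine ⟨q, ?_⟩
    simp [Subsingleton.elim _ (0 : Fin 1), h0.isSelfAdjoint.star_eq, h0.isIdempotentElem.eq, h0,
      sub_mul, hε]
  | succ n ih =>
    obtain ⟨v, hqv, hv, hort, hE, hvE, h0, hn⟩ := ih (fun i ↦ q i.castSucc) fun i ↦ hq _
    set E := ∑ i, star (v i) * v i with hE'
    obtain ⟨u, hqu, hup, hu, hun⟩ := hA.exists_partial_isometry hE (hq (Fin.last _)) hε
    have hEs : star E = E := hE.isSelfAdjoint
    have hEE : E * E = E := hE.isIdempotentElem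
    have hEv : ∀ i, E * star (v i) = star (v i) := fun i ↦ by
      simpa [hEs] using congr(star $(hvE i))
    have hpu : E * star u = 0 := by simpa [hEs] using congr(star $hup)
    have hvu : ∀ i, v i * star u = 0 := fun i ↦ by rw [← hvE i, mul_assoc, hpu, mul_zero]
    have huv : ∀ i, u * star (v i) = 0 := fun i ↦ by rw [← hEv i, ← mul_assoc, hup, zero_mul]
    have hfE : star u * u * E = 0 := by rw [mul_assoc, hup, mul_zero]
    have hEf : E * (star u * u) = 0 := by rw [← mul_assoc, hpu, zero_mul]
    have hf : IsStarProjection (star u * u) :=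
      ⟨by rw [IsIdempotentElem, mul_assoc, ← mul_assoc u, hu], IsSelfAdjoint.star_mul_self u⟩
    have hsum : ∑ i, star (Fin.snoc (α := fun _ ↦ A) v u i) * Fin.snoc (α := fun _ ↦ A) v u i =
        E + star u * u := by
      rw [Fin.sum_univ_castSucc]; simp [hE']
    have hprod : 1 - (E + star u * u) = (1 - star u * u) * (1 - E) := by
      rw [mul_sub, mul_one, sub_mul, hfE, one_mul, sub_zero]; abel
    refine ⟨Fin.snoc (α := fun _ ↦ A) v u, ?_, ?_, ?_, ?_, ?_, ?_, ?_⟩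
    · intro i
      cases i using Fin.lastCases <;> simp [hqu, hqv]
    · intro i
      cases i using Fin.lastCases <;> simp [hu, hv]
    · intro i j
      cases i using Fin.lastCases <;> cases j using Fin.lastCases <;> simp [hvu, huv]
      exact hort _ _
    · rw [hsum]
      refine ⟨?_, hE.isSelfAdjoint.add hf.isSelfAdjoint⟩
      rw [IsIdempotentElem, mul_add, add_mul, add_mul, hEE, hfE, hEf, hf.isIdempotentElem.eq]
      simp
    · intro i
      rw [hsum, mul_add]
      cases i using Fin.lastCases <;> simp [hvE, hup, ← mul_assoc, hu, hvu]
    · rw [hsum]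
      exact h0.trans (le_add_of_nonneg_right (star_mul_self_nonneg u))
    · intro k
      rw [hsum, hprod, mul_assoc]
      cases k using Fin.lastCases with
      | last => exact hun
      | cast k =>
        calc _ ≤ ‖1 - star u * u‖ * ‖(1 - E) * q k.castSucc‖ := norm_mul_le _ _
          _ ≤ 1 * ‖(1 - E) * q k.castSucc‖ := by gcongr; exact hf.one_sub.norm_le
          _ < ε := by rw [one_mul]; exact hn k

end ApproximateSupremum

/-- Let `A` be a unital C*-algebra with real rank zero, let
`q₀, q₁, …, qₙ ∈ A` be projections, and let `ε > 0`.  Then there exists a projection `e ∈ A`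
with `q₀ ≤ e`, `‖e qₖ − qₖ‖ < ε` for `1 ≤ k ≤ n`, and `e` is Murray–von Neumann subequivalent
to `q₀ ⊕ q₁ ⊕ ⋯ ⊕ qₙ` in `M_{n+1}(A)`: there is `s ∈ M_{n+1}(A)` with
`s* s = diag (e, 0, …, 0)` and `s s* ≤ diag (q₀, …, qₙ)` (the latter inequality expressed by
saying that the difference is positive, i.e. of the form `t* t`). -/
theorem exists_projection_approx_sup
    {A : Type*} [CStarAlgebra A] [PartialOrder A] [StarOrderedRing A]
    (hA : RealRankZero A) (n : ℕ) (q : Fin (n + 1) → A) (hq : ∀ k, IsProjection (q k))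
    (ε : ℝ) (hε : 0 < ε) :
    ∃ e : A, IsProjection e ∧ q 0 ≤ e ∧
      (∀ k : Fin (n + 1), k ≠ 0 → ‖e * q k - q k‖ < ε) ∧
      ∃ s t : Matrix (Fin (n + 1)) (Fin (n + 1)) A,
        star s * s = Matrix.diagonal (fun i => if i = 0 then e else 0) ∧
        Matrix.diagonal q - s * star s = star t * t := by
  have hq' : ∀ k, IsStarProjection (q k) := fun k ↦ ⟨(hq k).2, (hq k).1⟩
  obtain ⟨v, hqv, hv, hort, hE, -, h0, hn⟩ := hA.exists_orthogonal_partial_isometries n q hq' hε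
  refine ⟨∑ i, star (v i) * v i, ⟨hE.isSelfAdjoint, hE.isIdempotentElem⟩, h0, fun k _ ↦ ?_,
    Matrix.of fun i j ↦ if j = 0 then v i else 0,
    Matrix.diagonal fun i ↦ q i - v i * star (v i), ?_, ?_⟩
  · have h := hn k
    rwa [← norm_neg, ← neg_mul, neg_sub, sub_mul, one_mul] at h
  · ext i j
    rw [Matrix.mul_apply, Matrix.diagonal_apply]
    by_cases hi : i = 0 <;> by_cases hj : j = 0 <;>
      simp [Matrix.star_apply, hi, hj, eq_comm]
  · have hs : (Matrix.of fun i j ↦ if j = 0 then v i else 0 : Matrix (Fin (n + 1)) (Fin (n + 1)) A) *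
        star (Matrix.of fun i j ↦ if j = 0 then v i else 0) =
        Matrix.diagonal fun i ↦ v i * star (v i) := by
      ext i j
      rw [Matrix.mul_apply, Matrix.diagonal_apply, Finset.sum_eq_single 0]
      · by_cases hij : i = j
        · simp [Matrix.star_apply, hij]
        · simp [Matrix.star_apply, hij, hort i j hij]
      · intro k _ hk
        simp [hk]
      · simp
    rw [hs, Matrix.diagonal_sub, Matrix.star_eq_conjTranspose, Matrix.diagonal_conjTranspose,
      Matrix.diagonal_mul_diagonal]
    congr 1
    ext i
    have h1 : v i * star (v i) * q i = v i * star (v i) := by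
      have : star (v i) * q i = star (v i) := by simpa [(hq i).1] using congr(star $(hqv i))
      rw [mul_assoc, this]
    have h2 : v i * star (v i) * (v i * star (v i)) = v i * star (v i) := by
      rw [← mul_assoc, hv]
    simp only [Pi.star_apply, star_sub, star_mul, star_star, (hq i).1]
    rw [mul_sub, sub_mul, sub_mul, (hq i).2, h1, h2, ← mul_assoc, hqv]
    simp
end

section
/- For every ε > 0 and every n ∈ ℕ there is δ > 0 with the following property. Let A be a unital C*-algebra with real rank zero, let T be a set of tracial states on A, and let p, f₁, f₂, …, fₙ ∈ A be projections such that ‖p fₖ‖_{2,τ} < δ for 1 ≤ k ≤ n and all τ ∈ T. Then there exists a projection e ∈ A such that: (1) e ≤ p; (2) ‖e fₖ‖ < ε for 1 ≤ k ≤ n; (3) τ(e) > τ(p) − ε for all τ ∈ T. -/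
open ComplexOrder

/-- A tracial state on a unital C*-algebra: a unital positive linear functional with the
trace property. -/
def IsTracialState {A : Type*} [Ring A] [PartialOrder A] [StarRing A] [Module ℂ A]
    (τ : A →ₗ[ℂ] ℂ) : Prop :=
  τ 1 = 1 ∧ (∀ a : A, 0 ≤ a → 0 ≤ τ a) ∧ ∀ a b : A, τ (a * b) = τ (b * a)

/-- The trace seminorm `‖x‖_{2,τ} = τ(x* x)^(1/2)` associated with a tracial state `τ`. -/
noncomputable def traceSeminorm {A : Type*} [NonUnitalRing A] [StarRing A] [Module ℂ A]
    (τ : A →ₗ[ℂ] ℂ) (x : A) : ℝ :=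
  Real.sqrt (τ (star x * x)).re

/-- The Schur complement `pbp - pbq (qbq)⁻¹ qbp` of the corner `qbq`, put together with that corner,
is invertible when `b` is; here `q = 1 - p` and `w` inverts `p + qbq`. -/
theorem isUnit_schur {R : Type*} [Ring R] {p q b w : R} (hpq : p * q = 0) (hqp : q * p = 0)
    (hsum : p + q = 1) (hb : IsUnit b) (hw : w * (p + q * b * q) = 1)
    (hw' : (p + q * b * q) * w = 1) :
    IsUnit (p * b * p + q * b * q - p * b * q * w * (q * b * p)) := by
  have hqq : q * q = q := by
    calc q * q = (p + q) * q - p * q := by noncomm_ring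
      _ = q := by rw [hsum, hpq]; simp
  have hcq : (p + q * b * q) * q = q * b * q := by
    rw [add_mul, hpq, mul_assoc _ q q, hqq, zero_add]
  have hqc : q * (p + q * b * q) = q * b * q := by
    rw [mul_add, hqp, ← mul_assoc, ← mul_assoc, hqq, zero_add]
  have hwD : w * (q * b * q) = q := by rw [← hcq, ← mul_assoc, hw, one_mul]
  have hDw : q * b * q * w = q := by rw [← hqc, mul_assoc, hw', mul_one]
  have hcomm : w * q = q * w := by
    calc w * q = w * (q * b * q * w) := by rw [hDw]
      _ = q * w := by rw [← mul_assoc, hwD]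
  have hqwp : q * w * p = 0 := by rw [← hcomm, mul_assoc, hqp, mul_zero]
  have hpwq : p * w * q = 0 := by rw [mul_assoc, hcomm, ← mul_assoc, hpq, zero_mul]
  have hu1 : IsUnit (1 - p * b * q * w) := by
    refine IsNilpotent.isUnit_one_sub ⟨2, ?_⟩
    calc (p * b * q * w) ^ 2 = p * b * (q * w * p) * (b * q * w) := by noncomm_ring
      _ = 0 := by rw [hqwp]; simp
  have hu2 : IsUnit (1 - w * (q * b * p)) := by
    refine IsNilpotent.isUnit_one_sub ⟨2, ?_⟩
    calc (w * (q * b * p)) ^ 2 = w * q * b * (p * w * q) * (b * p) := by noncomm_ring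
      _ = 0 := by rw [hpwq]; simp
  have h1 : p * b * q * w * b = p * b * q + p * b * q * w * (q * b * p) := by
    calc p * b * q * w * b = p * b * (q * q) * w * b * (p + q) := by rw [hqq, hsum, mul_one]
      _ = p * b * q * (q * w) * b * (p + q) := by noncomm_ring
      _ = p * b * q * (w * (q * b * q)) + p * b * q * w * (q * b * p) := by
        rw [← hcomm]; noncomm_ring
      _ = p * b * (q * q) + p * b * q * w * (q * b * p) := by rw [hwD]; noncomm_ring
      _ = _ := by rw [hqq]
  have h2 : b * (w * (q * b * p)) = q * b * p + p * b * q * w * (q * b * p) := by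
    calc b * (w * (q * b * p)) = (p + q) * b * (w * ((q * q) * b * p)) := by
          rw [hqq, hsum, one_mul]
      _ = (p + q) * b * ((w * q) * (q * b * p)) := by noncomm_ring
      _ = (q * b * q * w) * (q * b * p) + p * b * q * w * (q * b * p) := by
        rw [hcomm]; noncomm_ring
      _ = (q * q) * b * p + p * b * q * w * (q * b * p) := by rw [hDw]; noncomm_ring
      _ = _ := by rw [hqq]
  have h3 : p * b * q * w * (q * b * p) * (w * (q * b * p)) = 0 := by
    calc p * b * q * w * (q * b * p) * (w * (q * b * p))
        = p * b * q * w * (q * b) * (p * w * q) * (b * p) := by noncomm_ring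
      _ = 0 := by rw [hpwq]; simp
  have h4 : b = p * b * p + p * b * q + q * b * p + q * b * q := by
    calc b = (p + q) * b * (p + q) := by rw [hsum]; simp
      _ = _ := by noncomm_ring
  have key : (1 - p * b * q * w) * b * (1 - w * (q * b * p)) =
      p * b * p + q * b * q - p * b * q * w * (q * b * p) := by
    calc (1 - p * b * q * w) * b * (1 - w * (q * b * p))
        = b - b * (w * (q * b * p)) - p * b * q * w * b
          + p * b * q * w * b * (w * (q * b * p)) := by noncomm_ring
      _ = b - (q * b * p + p * b * q * w * (q * b * p))
          - (p * b * q + p * b * q * w * (q * b * p))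
          + (p * b * q * (w * (q * b * p)) +
            p * b * q * w * (q * b * p) * (w * (q * b * p))) := by
        rw [h2, h1]; noncomm_ring
      _ = (p * b * p + p * b * q + q * b * p + q * b * q)
          - (q * b * p + p * b * q * w * (q * b * p))
          - (p * b * q + p * b * q * w * (q * b * p))
          + p * b * q * (w * (q * b * p)) := by rw [h3, ← h4]; noncomm_ring
      _ = _ := by noncomm_ring
  rw [← key]
  exact (hu1.mul hb).mul hu2

theorem IsProjection.isStarProjection {A : Type*} [Mul A] [Star A] {p : A}
    (hp : IsProjection p) : IsStarProjection p :=
  ⟨hp.2, hp.1⟩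

/-- In a C*-algebra of real rank zero, a self-adjoint element of a corner `pAp`, extended by the
unit of the complementary corner, is a limit of invertible self-adjoint elements commuting
with `p`. -/
theorem RealRankZero.exists_isUnit_commute {A : Type*} [CStarAlgebra A] (hA : RealRankZero A)
    {p a : A} (hp : IsProjection p) (ha : IsSelfAdjoint a) (hap : p * a * p = a)
    {r : ℝ} (hr : 0 < r) :
    ∃ y : A, IsSelfAdjoint y ∧ IsUnit y ∧ Commute p y ∧ ‖y - (a + (1 - p))‖ ≤ r := by
  obtain ⟨hps, hpp⟩ := hp
  obtain ⟨q, hq⟩ : ∃ q, q = 1 - p := ⟨_, rfl⟩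
  have hsum : p + q = 1 := by rw [hq]; abel
  have hqs : star q = q := by rw [hq]; simp [hps]
  have hqq : q * q = q := by rw [hq, mul_sub, sub_mul, sub_mul, hpp]; simp
  have hpq : p * q = 0 := by rw [hq, mul_sub, hpp]; simp
  have hqp : q * p = 0 := by rw [hq, sub_mul, hpp]; simp
  have hpn : ‖p‖ ≤ 1 := IsStarProjection.norm_le p ⟨hpp, hps⟩
  have hqn : ‖q‖ ≤ 1 := IsStarProjection.norm_le q ⟨hqq, hqs⟩
  have h1n : ‖(1 : A)‖ ≤ 1 := IsStarProjection.norm_le 1 ⟨one_mul 1, star_one A⟩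
  have hcut : ∀ {s t : A} (x : A), ‖s‖ ≤ 1 → ‖t‖ ≤ 1 → ‖s * x * t‖ ≤ ‖x‖ := by
    intro s t x hs ht
    calc ‖s * x * t‖ ≤ ‖s‖ * ‖x‖ * ‖t‖ := norm_mul₃_le
      _ ≤ 1 * ‖x‖ * 1 := by gcongr
      _ = ‖x‖ := by ring
  have hasum : IsSelfAdjoint (a + q) := ha.add hqs
  set θ : ℝ := min (1 / 2) (r / 3) with hθ
  have hθ0 : 0 < θ := by positivity
  have hθ1 : θ ≤ 1 / 2 := min_le_left _ _
  have hθ2 : θ ≤ r / 3 := min_le_right _ _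
  obtain ⟨b, hbs, hbu, hbn⟩ := hA (a + q) hasum θ hθ0
  obtain ⟨d, hd⟩ : ∃ d, d = b - (a + q) := ⟨_, rfl⟩
  have hdn : ‖d‖ ≤ θ := by rw [hd, norm_sub_rev]; exact hbn.le
  have hb : b = a + q + d := by rw [hd]; abel
  have hqa : q * a = 0 := by rw [← hap, ← mul_assoc, ← mul_assoc, hqp]; simp
  have haq : a * q = 0 := by rw [← hap, mul_assoc, hpq]; simp
  have e1 : p * b * p = a + p * d * p := by
    rw [hb, mul_add, mul_add, hpq, add_mul, add_mul, hap]; simp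
  have e2 : q * b * q = q + q * d * q := by
    rw [hb, mul_add, mul_add, hqa, hqq, add_mul, add_mul, hqq]; simp
  have e3 : p * b * q = p * d * q := by
    rw [hb, mul_add, mul_add, hpq, add_mul, add_mul, mul_assoc p a, haq]; simp
  have e4 : q * b * p = q * d * p := by
    rw [hb, mul_add, mul_add, hqa, hqq, add_mul, add_mul, hqp]; simp
  have hc : p + q * b * q = 1 - (-(q * d * q)) := by rw [e2, ← hsum]; abel
  have hqdq : ‖q * d * q‖ ≤ θ := (hcut d hqn hqn).trans hdn
  have hcu : IsUnit (p + q * b * q) := by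
    rw [hc]
    refine isUnit_one_sub_of_norm_lt_one ?_
    rw [norm_neg]; linarith
  obtain ⟨u, hu⟩ := hcu
  obtain ⟨w, hwdef⟩ : ∃ w : A, w = ↑u⁻¹ := ⟨_, rfl⟩
  have hw : w * (p + q * b * q) = 1 := by rw [← hu, hwdef]; simp
  have hw' : (p + q * b * q) * w = 1 := by rw [← hu, hwdef]; simp
  have hcs : star (p + q * b * q) = p + q * b * q := by
    simp [hps, hqs, hbs.star_eq, mul_assoc]
  have hws : star w = w := by
    have h := congrArg star hw'
    rw [star_mul, hcs, star_one] at h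
    calc star w = star w * ((p + q * b * q) * w) := by rw [hw', mul_one]
      _ = w := by rw [← mul_assoc, h, one_mul]
  have hwn : ‖w‖ ≤ 2 := by
    have h : w = 1 - q * d * q * w := by
      have : p + q * b * q = 1 + q * d * q := by rw [hc]; abel
      rw [this, add_mul, one_mul] at hw'
      rw [← hw']; abel
    have h' : ‖w‖ ≤ 1 + θ * ‖w‖ := by
      calc ‖w‖ = ‖1 - q * d * q * w‖ := by rw [← h]
        _ ≤ ‖(1 : A)‖ + ‖q * d * q * w‖ := norm_sub_le _ _
        _ ≤ 1 + ‖q * d * q‖ * ‖w‖ := add_le_add h1n (norm_mul_le _ _)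
        _ ≤ 1 + θ * ‖w‖ := by gcongr
    nlinarith [norm_nonneg w]
  refine ⟨p * b * p + q * b * q - p * b * q * w * (q * b * p), ?_,
    isUnit_schur hpq hqp hsum hbu hw hw', ?_, ?_⟩
  · rw [isSelfAdjoint_iff]
    simp [hps, hqs, hbs.star_eq, hws, mul_assoc]
  · have hl : p * (p * b * p + q * b * q - p * b * q * w * (q * b * p)) =
        p * b * p - p * b * q * w * (q * b * p) := by
      simp only [mul_sub, mul_add, ← mul_assoc, hpp, hpq]; simp
    have hr' : (p * b * p + q * b * q - p * b * q * w * (q * b * p)) * p =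
        p * b * p - p * b * q * w * (q * b * p) := by
      simp only [sub_mul, add_mul, mul_assoc, hpp, hqp]; simp
    exact hl.trans hr'.symm
  · have hdiff : p * b * p + q * b * q - p * b * q * w * (q * b * p) - (a + (1 - p)) =
        p * d * p + q * d * q - p * d * q * w * (q * d * p) := by
      rw [e1, e2, e3, e4, ← hq]; abel
    rw [hdiff]
    have hpdp : ‖p * d * p‖ ≤ θ := (hcut d hpn hpn).trans hdn
    have hpdq : ‖p * d * q‖ ≤ θ := (hcut d hpn hqn).trans hdn
    have hqdp : ‖q * d * p‖ ≤ θ := (hcut d hqn hpn).trans hdn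
    have h3 : ‖p * d * q * w * (q * d * p)‖ ≤ θ * 2 * θ :=
      norm_mul₃_le.trans (by gcongr)
    have h4 := norm_sub_le (p * d * p + q * d * q) (p * d * q * w * (q * d * p))
    have h5 := norm_add_le (p * d * p) (q * d * q)
    nlinarith

/-- The negative spectral projection of an invertible self-adjoint element. -/
theorem IsSelfAdjoint.exists_spectral_projection_s6 {A : Type*} [CStarAlgebra A] [PartialOrder A]
    [StarOrderedRing A] {y : A} (hy : IsSelfAdjoint y) (hu : IsUnit y) :
    ∃ c : A, IsProjection c ∧ (∀ b, Commute b y → Commute b c) ∧ c * y * c ≤ 0 ∧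
      0 ≤ (1 - c) * y * (1 - c) := by
  have h0 : (0 : ℝ) ∉ spectrum ℝ y := spectrum.zero_notMem ℝ hu
  set g : ℝ → ℝ := fun t => if t < 0 then 1 else 0 with hg
  have hgc : ContinuousOn g (spectrum ℝ y) := by
    intro t ht
    refine ContinuousAt.continuousWithinAt ?_
    have ht0 : t ≠ 0 := fun h => h0 (h ▸ ht)
    rcases lt_or_gt_of_ne ht0 with h | h
    · refine (continuousAt_const (y := (1 : ℝ))).congr ?_
      filter_upwards [Iio_mem_nhds h] with s hs
      simp [hg, Set.mem_Iio.1 hs]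
    · refine (continuousAt_const (y := (0 : ℝ))).congr ?_
      filter_upwards [Ioi_mem_nhds h] with s hs
      simp [hg, (Set.mem_Ioi.1 hs).le]
  have hid : ContinuousOn (fun t : ℝ => t) (spectrum ℝ y) := continuousOn_id
  have hcs : IsSelfAdjoint (cfc g y) := cfc_predicate g y
  have hcc : cfc g y * cfc g y = cfc g y := by
    rw [← cfc_mul g g y hgc hgc]
    congr 1
    funext t
    simp [hg]
  have hcy : cfc g y * y * cfc g y = cfc (fun t => g t * t * g t) y := by
    rw [cfc_mul (fun t => g t * t) g y (hgc.mul hid) hgc, cfc_mul g (fun t => t) y hgc hid,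
      cfc_id' ℝ y]
  have hdy : (1 - cfc g y) * y * (1 - cfc g y) =
      cfc (fun t => (1 - g t) * t * (1 - g t)) y := by
    have hk : ContinuousOn (fun t => 1 - g t) (spectrum ℝ y) := continuousOn_const.sub hgc
    rw [cfc_mul (fun t => (1 - g t) * t) (fun t => 1 - g t) y (hk.mul hid) hk,
      cfc_mul (fun t => 1 - g t) (fun t => t) y hk hid,
      cfc_id' ℝ y, cfc_sub (fun _ => (1 : ℝ)) g y continuousOn_const hgc, cfc_const_one ℝ y]
  refine ⟨cfc g y, ⟨hcs, hcc⟩, fun b hb => (hb.symm.cfc_real g).symm, ?_, ?_⟩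
  · rw [hcy]
    refine cfc_nonpos _ _ fun t _ => ?_
    by_cases h : t < 0
    · simp [hg, h, h.le]
    · simp [hg, h]
  · rw [hdy]
    refine cfc_nonneg fun t _ => ?_
    by_cases h : t < 0
    · simp [hg, h]
    · simpa [hg, h] using not_lt.1 h

/-- Approximate spectral projections inside a corner of a C*-algebra of real rank zero. -/
theorem RealRankZero.exists_subprojection {A : Type*} [CStarAlgebra A] [PartialOrder A]
    [StarOrderedRing A] (hA : RealRankZero A) {p a : A} (hp : IsProjection p)
    (ha : IsSelfAdjoint a) (hap : p * a * p = a) {r : ℝ} (hr : 0 < r) :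
    ∃ e : A, IsProjection e ∧ IsProjection (p - e) ∧ e * p = e ∧
      e * a * e ≤ r • e ∧ -(r • (p - e)) ≤ (p - e) * a * (p - e) := by
  obtain ⟨y, hys, hyu, hpy, hyn⟩ := hA.exists_isUnit_commute hp ha hap hr
  obtain ⟨c, ⟨hcs, hcc⟩, hcomm, hc1, hc2⟩ := hys.exists_spectral_projection_s6 hyu
  have hpc : p * c = c * p := hcomm p hpy
  obtain ⟨hps, hpp⟩ := hp
  have hxs : IsSelfAdjoint (a + (1 - p)) := by
    refine ha.add ?_
    rw [isSelfAdjoint_iff]; simp [hps]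
  have hds : IsSelfAdjoint (y - (a + (1 - p))) := hys.sub hxs
  have hn : algebraMap ℝ A ‖y - (a + (1 - p))‖ ≤ algebraMap ℝ A r := by
    exact algebraMap_mono A hyn
  have hd1 : y - (a + (1 - p)) ≤ algebraMap ℝ A r := hds.le_algebraMap_norm_self.trans hn
  have hd2 : -algebraMap ℝ A r ≤ y - (a + (1 - p)) :=
    (neg_le_neg hn).trans hds.neg_algebraMap_norm_le_self
  have hcorner : ∀ e : A, IsProjection e → e * p = e → ∀ t : ℝ,
      e * (algebraMap ℝ A t) * e = t • e ∧ e * (y - (a + (1 - p))) * e = e * y * e - e * a * e := by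
    intro e he hep t
    constructor
    · rw [Algebra.algebraMap_eq_smul_one]; simp [he.2]
    · simp [mul_sub, mul_add, sub_mul, hep]
  have hcp : c * p * (c * p) = c * p := by
    rw [mul_assoc, ← mul_assoc p, hpc, mul_assoc c p p, hpp, ← mul_assoc, hcc]
  have he : IsProjection (c * p) := ⟨by rw [star_mul, hps, hcs, hpc], hcp⟩
  have hpcp : p * (c * p) = c * p := by rw [← mul_assoc, hpc, mul_assoc, hpp]
  have hep : c * p * p = c * p := by rw [mul_assoc, hpp]
  have hf : IsProjection (p - c * p) := by
    refine ⟨by rw [star_sub, he.1, hps], ?_⟩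
    rw [sub_mul, mul_sub, mul_sub, hpp, hpcp, hep, hcp]; abel
  have hfp : (p - c * p) * p = p - c * p := by rw [sub_mul, hpp, hep]
  refine ⟨c * p, he, hf, hep, ?_, ?_⟩
  · have h1 : c * p * y * (c * p) ≤ 0 := by
      have h := star_left_conjugate_le_conjugate hc1 p
      rw [hps] at h
      calc c * p * y * (c * p) = p * c * y * (c * p) := by rw [hpc]
        _ = p * (c * y * c) * p := by simp only [mul_assoc]
        _ ≤ 0 := by simpa using h
    have h2 := star_left_conjugate_le_conjugate hd2 (c * p)
    rw [he.1, mul_neg, neg_mul, (hcorner _ he hep r).1, (hcorner _ he hep r).2] at h2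
    have h3 : c * p * a * (c * p) ≤ c * p * y * (c * p) + r • (c * p) := by
      rw [neg_le_sub_iff_le_add] at h2
      exact h2
    exact h3.trans (by simpa using add_le_add_left h1 (r • (c * p)))
  · have h1 : 0 ≤ (p - c * p) * y * (p - c * p) := by
      have h := star_left_conjugate_le_conjugate hc2 p
      rw [hps] at h
      have hl : p - c * p = p * (1 - c) := by rw [mul_sub, mul_one, hpc]
      have hr' : p - c * p = (1 - c) * p := by rw [sub_mul, one_mul]
      calc (0 : A) ≤ p * ((1 - c) * y * (1 - c)) * p := by simpa using h
        _ = (p * (1 - c)) * y * ((1 - c) * p) := by simp only [mul_assoc]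
        _ = _ := by rw [← hl, ← hr']
    have h2 := star_left_conjugate_le_conjugate hd1 (p - c * p)
    rw [hf.1, (hcorner _ hf hfp r).1, (hcorner _ hf hfp r).2] at h2
    rw [neg_le_iff_add_nonneg]
    refine h1.trans ?_
    rw [add_comm]
    exact sub_le_iff_le_add.1 h2

/-- Compressing by a smaller projection decreases the trace of a projection. -/
theorem IsTracialState.re_compress_le {A : Type*} [CStarAlgebra A] [PartialOrder A]
    [StarOrderedRing A] {τ : A →ₗ[ℂ] ℂ} (hτ : IsTracialState τ) {p g f : A}
    (hp : IsProjection p) (hg : IsProjection g) (hf : IsProjection f) (hgp : g ≤ p) :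
    (τ (g * f * g)).re ≤ (τ (star (p * f) * (p * f))).re := by
  have h1 : τ (g * f * g) = τ (f * g * f) := by
    calc τ (g * f * g) = τ ((g * f) * (f * g)) := by
          rw [mul_assoc g f (f * g), ← mul_assoc f f g, hf.2, mul_assoc]
      _ = τ ((f * g) * (g * f)) := hτ.2.2 _ _
      _ = τ (f * g * f) := by rw [mul_assoc f g (g * f), ← mul_assoc g g f, hg.2, mul_assoc]
  have h2 : star (p * f) * (p * f) = f * p * f := by
    rw [star_mul, hp.1, hf.1, mul_assoc f p (p * f), ← mul_assoc p p f, hp.2, mul_assoc]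
  rw [h1, h2]
  have h3 : 0 ≤ f * p * f - f * g * f := by
    have h := star_left_conjugate_le_conjugate hgp f
    rw [hf.1] at h
    exact sub_nonneg.2 h
  have h4 := (Complex.le_def.1 (hτ.2.1 _ h3)).1
  rw [map_sub, Complex.sub_re, Complex.zero_re] at h4
  linarith

/-- For every `ε > 0` and `n ∈ ℕ` there is `δ > 0` such that: if `A` is a
unital C*-algebra with real rank zero, `T` is a set of tracial states on `A`, and
`p, f₁, …, fₙ ∈ A` are projections with `‖p fₖ‖_{2,τ} < δ` for all `k` and all `τ ∈ T`, then
there is a projection `e ∈ A` with `e ≤ p`, `‖e fₖ‖ < ε` for all `k`, and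
`τ e > τ p − ε` for all `τ ∈ T`. -/
theorem exists_subprojection_almost_orthogonal (ε : ℝ) (hε : 0 < ε) (n : ℕ) :
    ∃ δ > (0 : ℝ), ∀ (A : Type*) [CStarAlgebra A] [PartialOrder A] [StarOrderedRing A],
      RealRankZero A → ∀ (T : Set (A →ₗ[ℂ] ℂ)), (∀ τ ∈ T, IsTracialState τ) →
      ∀ (p : A) (f : Fin n → A), IsProjection p → (∀ k, IsProjection (f k)) →
      (∀ k, ∀ τ ∈ T, traceSeminorm τ (p * f k) < δ) →
      ∃ e : A, IsProjection e ∧ e ≤ p ∧ (∀ k, ‖e * f k‖ < ε) ∧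
        ∀ τ ∈ T, τ p - (ε : ℂ) < τ e := by
  have hn0 : (0 : ℝ) < 4 * (n + 1) := by positivity
  refine ⟨Real.sqrt (ε ^ 3 / (4 * (n + 1))), by positivity, ?_⟩
  intro A _ _ _ hA T hT p f hp hf hδ
  have hS : IsSelfAdjoint (∑ k, f k) := by
    rw [isSelfAdjoint_iff, star_sum]
    exact Finset.sum_congr rfl fun k _ => (hf k).1
  have ha : IsSelfAdjoint (p * (∑ k, f k) * p - (ε ^ 2 / 2) • p) := by
    rw [isSelfAdjoint_iff]
    simp [hp.1, hS.star_eq, mul_assoc, star_smul]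
  have hap : p * (p * (∑ k, f k) * p - (ε ^ 2 / 2) • p) * p =
      p * (∑ k, f k) * p - (ε ^ 2 / 2) • p := by
    rw [mul_sub, sub_mul, mul_smul_comm, smul_mul_assoc, hp.2, hp.2, ← mul_assoc, ← mul_assoc,
      hp.2, mul_assoc _ p p, hp.2]
  obtain ⟨e, he, hg, hep, h1, h2⟩ :=
    hA.exists_subprojection hp ha hap (r := ε ^ 2 / 4) (by positivity)
  have hcut : ∀ x : A, IsProjection x → x * p = x →
      x * (p * (∑ k, f k) * p - (ε ^ 2 / 2) • p) * x =
        ∑ k, x * f k * x - (ε ^ 2 / 2) • x := by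
    intro x hx hxp
    have hpx : p * x = x := by
      have h := congrArg star hxp
      rwa [star_mul, hx.1, hp.1] at h
    rw [mul_sub, sub_mul, mul_smul_comm, smul_mul_assoc, hxp, hx.2, ← mul_assoc, ← mul_assoc,
      hxp, mul_assoc _ p x, hpx, Finset.mul_sum, Finset.sum_mul]
  have hgp : (p - e) * p = p - e := by rw [sub_mul, hp.2, hep]
  rw [hcut e he hep] at h1
  rw [hcut (p - e) hg hgp] at h2
  have hnonneg : ∀ {x : A}, IsProjection x → 0 ≤ x := fun {x} hx => by
    have h := star_mul_self_nonneg x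
    rwa [hx.1, hx.2] at h
  have hele : e ≤ p := sub_nonneg.1 (hnonneg hg)
  have hpe : p - e ≤ p := sub_le_self _ (hnonneg he)
  have hcomp : ∀ {x : A}, IsProjection x → ∀ k, 0 ≤ x * f k * x := fun {x} hx k => by
    have h := star_left_conjugate_nonneg (hnonneg (hf k)) x
    rwa [hx.1] at h
  refine ⟨e, he, hele, fun k => ?_, fun τ hτ => ?_⟩
  · have h3 : e * f k * e ≤ (3 * ε ^ 2 / 4) • e := by
      calc e * f k * e ≤ ∑ j, e * f j * e :=
            Finset.single_le_sum (f := fun j => e * f j * e) (fun j _ => hcomp he j)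
              (Finset.mem_univ k)
        _ ≤ (ε ^ 2 / 4) • e + (ε ^ 2 / 2) • e := sub_le_iff_le_add.1 h1
        _ = (3 * ε ^ 2 / 4) • e := by rw [← add_smul]; congr 1; ring
    have h4 : ‖e * f k * e‖ ≤ 3 * ε ^ 2 / 4 := by
      calc ‖e * f k * e‖ ≤ ‖(3 * ε ^ 2 / 4) • e‖ :=
            CStarAlgebra.norm_le_norm_of_nonneg_of_le (hcomp he k) h3
        _ = 3 * ε ^ 2 / 4 * ‖e‖ := by
          rw [norm_smul, Real.norm_of_nonneg (by positivity)]
        _ ≤ 3 * ε ^ 2 / 4 * 1 := by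
          gcongr
          exact IsStarProjection.norm_le e he.isStarProjection
        _ = _ := mul_one _
    have h5 : ‖e * f k‖ * ‖e * f k‖ = ‖e * f k * e‖ := by
      rw [← CStarRing.norm_self_mul_star, star_mul, (hf k).1, he.1, mul_assoc e (f k),
        ← mul_assoc (f k) (f k), (hf k).2, mul_assoc]
    refine lt_of_pow_lt_pow_left₀ 2 hε.le ?_
    nlinarith
  · have ht := hT τ hτ
    have h3 : ∀ k, (τ ((p - e) * f k * (p - e))).re ≤ ε ^ 3 / (4 * (n + 1)) := fun k => by
      refine (ht.re_compress_le hp hg (hf k) hpe).trans ?_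
      by_contra! h
      exact (hδ k τ hτ).not_ge (Real.sqrt_le_sqrt h.le)
    have h4 := Complex.le_def.1 (ht.2.1 _ (hnonneg hg))
    have h5 := (Complex.le_def.1 (ht.2.1 _ (sub_nonneg.2 h2))).1
    rw [sub_neg_eq_add, map_add, map_sub, LinearMap.map_smul_of_tower,
      LinearMap.map_smul_of_tower, map_sum, Complex.add_re, Complex.sub_re, Complex.re_sum,
      Complex.smul_re, Complex.smul_re, smul_eq_mul, smul_eq_mul, Complex.zero_re] at h5
    have h6 : ∑ k, (τ ((p - e) * f k * (p - e))).re ≤ n * (ε ^ 3 / (4 * (n + 1))) := by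
      simpa using Finset.sum_le_card_nsmul Finset.univ _ _ fun k _ => h3 k
    have h7 : n * (ε ^ 3 / (4 * (n + 1))) < ε ^ 2 / 4 * ε := by
      rw [mul_div_assoc', div_lt_iff₀ hn0]
      nlinarith [pow_pos hε 3]
    have h8 : (τ (p - e)).re < ε := by
      refine lt_of_mul_lt_mul_left ?_ (by positivity : (0 : ℝ) ≤ ε ^ 2 / 4)
      nlinarith
    rw [map_sub, Complex.sub_re] at h8
    have h9 := h4.2
    rw [map_sub, Complex.sub_im, Complex.zero_im] at h9
    rw [Complex.lt_def]
    constructor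
    · simp only [Complex.sub_re, Complex.ofReal_re]; linarith
    · simp only [Complex.sub_im, Complex.ofReal_im]; linarith
end

section
/- For every ε > 0 and every n ∈ ℕ there is δ > 0 with the following property. Let A be a unital C*-algebra with real rank zero, let T be a set of tracial states on A, and let (e_{j,k})_{1 ≤ j,k ≤ n} be a system of matrix units in A with identity e = Σ_{k=1}^n e_{k,k}. If p ∈ A is a projection with p ≤ e such that ‖p e_{j,k} − e_{j,k} p‖_{2,τ} < δ for all 1 ≤ j, k ≤ n and all τ ∈ T, then there is a projection q ∈ A with q ≤ e which commutes with every e_{j,k} and satisfies ‖q − p‖_{2,τ} < ε for all τ ∈ T. -/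
open ComplexOrder

lemma isProjection_iff_isStarProjection {A : Type*} [Mul A] [Star A] {p : A} :
    IsProjection p ↔ IsStarProjection p :=
  ⟨fun h => ⟨h.2, h.1⟩, fun h => ⟨h.isSelfAdjoint, h.isIdempotentElem⟩⟩

lemma traceSeminorm_nonneg {A : Type*} [NonUnitalRing A] [StarRing A] [Module ℂ A]
    (τ : A →ₗ[ℂ] ℂ) (x : A) : 0 ≤ traceSeminorm τ x :=
  Real.sqrt_nonneg _

lemma IsTracialState.traceSeminorm_star {A : Type*} [Ring A] [PartialOrder A] [StarRing A]
    [Module ℂ A] {τ : A →ₗ[ℂ] ℂ} (h : IsTracialState τ) (x : A) :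
    traceSeminorm τ (star x) = traceSeminorm τ x := by
  simp [traceSeminorm, h.2.2 x]

namespace IsTracialState

variable {A : Type*} [CStarAlgebra A] [PartialOrder A] [StarOrderedRing A] {τ : A →ₗ[ℂ] ℂ}

/-- The seminorm of the GNS construction is the trace seminorm. -/
lemma traceSeminorm_eq_norm (h : IsTracialState τ) (x : A) :
    traceSeminorm τ x =
      ‖(PositiveLinearMap.mk₀ τ h.2.1).toPreGNS x‖ := rfl

lemma traceSeminorm_add_le (h : IsTracialState τ) (x y : A) :
    traceSeminorm τ (x + y) ≤ traceSeminorm τ x + traceSeminorm τ y := by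
  simp only [h.traceSeminorm_eq_norm, map_add]
  exact norm_add_le _ _

lemma traceSeminorm_sub_le (h : IsTracialState τ) (x y : A) :
    traceSeminorm τ (x - y) ≤ traceSeminorm τ x + traceSeminorm τ y := by
  simp only [h.traceSeminorm_eq_norm, map_sub]
  exact norm_sub_le _ _

lemma traceSeminorm_sum_le (h : IsTracialState τ) {ι : Type*} (s : Finset ι) (x : ι → A) :
    traceSeminorm τ (∑ i ∈ s, x i) ≤ ∑ i ∈ s, traceSeminorm τ (x i) := by
  simp only [h.traceSeminorm_eq_norm, map_sum]
  exact norm_sum_le _ _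

lemma traceSeminorm_mul_le_left (h : IsTracialState τ) (a x : A) :
    traceSeminorm τ (a * x) ≤ ‖a‖ * traceSeminorm τ x := by
  simp only [h.traceSeminorm_eq_norm]
  set f := PositiveLinearMap.mk₀ τ h.2.1
  refine ((f.leftMulMapPreGNS a).le_opNorm (f.toPreGNS x)).trans ?_
  gcongr
  exact LinearMap.mkContinuous_norm_le _ (norm_nonneg _) _

lemma traceSeminorm_mul_le_right (h : IsTracialState τ) (x a : A) :
    traceSeminorm τ (x * a) ≤ ‖a‖ * traceSeminorm τ x := by
  simpa [h.traceSeminorm_star, ← h.traceSeminorm_star (x * a)] using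
    h.traceSeminorm_mul_le_left (star a) (star x)

lemma traceSeminorm_le_norm (h : IsTracialState τ) (x : A) : traceSeminorm τ x ≤ ‖x‖ := by
  simpa [traceSeminorm, h.1] using h.traceSeminorm_mul_le_left x 1

lemma traceSeminorm_mul_le_of_norm_le_one (h : IsTracialState τ) {a x b : A}
    (ha : ‖a‖ ≤ 1) (hb : ‖b‖ ≤ 1) :
    traceSeminorm τ (a * x * b) ≤ traceSeminorm τ x := by
  have h0 := traceSeminorm_nonneg τ x
  calc _ ≤ ‖b‖ * (‖a‖ * traceSeminorm τ x) :=
        (h.traceSeminorm_mul_le_right _ _).trans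
          (by gcongr; exact h.traceSeminorm_mul_le_left _ _)
    _ ≤ 1 * (1 * traceSeminorm τ x) := by gcongr
    _ = _ := by ring

end IsTracialState

section Corner

variable {A : Type*} [CStarAlgebra A]

/-- In a C*-algebra of real rank zero, a self-adjoint element of the form `x + (1 - e)` with
`x ∈ eAe` can be approximated by invertible self-adjoint elements commuting with `e`. -/
lemma RealRankZero.exists_isUnit_commute_s8 (hA : RealRankZero A) {e x : A}
    (he : IsStarProjection e) (hx : IsSelfAdjoint x) (hxf : x * (1 - e) = 1 - e)
    {η : ℝ} (hη : 0 < η) :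
    ∃ z : A, IsSelfAdjoint z ∧ IsUnit z ∧ Commute z e ∧ ‖z - x‖ < η := by
  obtain ⟨y, hy, hyu, hxy⟩ := hA x hx (min (1 / 2) (η / 4)) (by positivity)
  have hxy₁ : ‖x - y‖ < 1 / 2 := hxy.trans_le (min_le_left _ _)
  have hxy₂ : ‖x - y‖ < η / 4 := hxy.trans_le (min_le_right _ _)
  obtain ⟨f, hf⟩ : ∃ f, f = 1 - e := ⟨_, rfl⟩
  rw [← hf] at hxf
  have hfp : IsStarProjection f := hf ▸ he.one_sub
  have hee : e * e = e := he.isIdempotentElem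
  have hff : f * f = f := hfp.isIdempotentElem
  have hes : star e = e := he.isSelfAdjoint
  have hfs : star f = f := hfp.isSelfAdjoint
  have hys : star y = y := hy
  have hef : e * f = 0 := hf ▸ he.mul_one_sub_self
  have hfe : f * e = 0 := hf ▸ he.one_sub_mul_self
  have hsum : e + f = 1 := by rw [hf]; abel
  have hne : ‖e‖ ≤ 1 := he.norm_le
  have hnf : ‖f‖ ≤ 1 := hfp.norm_le
  have hfx : f * x = f := by
    simpa [hx.star_eq, hfs] using congrArg star hxf
  have hexf : e * x * f = 0 := by rw [mul_assoc, hxf, hef]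
  have hfxf : f * x * f = f := by rw [hfx, hff]
  have hcomp : ∀ {a b : A} (w : A), ‖a‖ ≤ 1 → ‖b‖ ≤ 1 → ‖a * w * b‖ ≤ ‖w‖ := by
    intro a b w ha hb
    calc _ ≤ ‖a‖ * ‖w‖ * ‖b‖ := norm_mul₃_le
      _ ≤ 1 * ‖w‖ * 1 := by gcongr
      _ = _ := by ring
  -- the corner `f * y * f` is invertible in `fAf`
  have hDn : ‖1 - (f * y * f + e)‖ < 1 / 2 := by
    have : 1 - (f * y * f + e) = f * (x - y) * f := by
      rw [mul_sub, sub_mul, hfxf, ← hsum]; abel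
    rw [this]
    exact (hcomp _ hnf hnf).trans_lt hxy₁
  have hDu : IsUnit (f * y * f + e) := by
    have := isUnit_one_sub_of_norm_lt_one (hDn.trans (by norm_num))
    simpa using this
  obtain ⟨u, hu⟩ := hDu
  set v : A := ↑u⁻¹ with hv
  have hvD : v * (f * y * f + e) = 1 := by rw [← hu]; simp [hv]
  have hDv : (f * y * f + e) * v = 1 := by rw [← hu]; simp [hv]
  have hev : e * v = e := by
    have : e * (f * y * f + e) = e := by
      simp only [mul_add, ← mul_assoc, hef, hee, zero_mul, zero_add]
    calc e * v = e * (f * y * f + e) * v := by rw [this]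
      _ = e := by rw [mul_assoc, hDv, mul_one]
  have hve : v * e = e := by
    have : (f * y * f + e) * e = e := by
      simp only [add_mul, mul_assoc, hfe, hee, mul_zero, zero_add]
    calc v * e = v * ((f * y * f + e) * e) := by rw [this]
      _ = e := by rw [← mul_assoc, hvD, one_mul]
  have hvn : ‖v‖ ≤ 2 := by
    have h1 : v = 1 + v * (1 - (f * y * f + e)) := by rw [mul_sub, hvD]; simp
    have h2 : ‖v‖ ≤ 1 + ‖v‖ * (1 / 2) := by
      calc ‖v‖ = ‖1 + v * (1 - (f * y * f + e))‖ := by rw [← h1]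
        _ ≤ ‖(1 : A)‖ + ‖v‖ * ‖1 - (f * y * f + e)‖ :=
          (norm_add_le _ _).trans (by gcongr; exact norm_mul_le _ _)
        _ ≤ _ := by
          gcongr
          exact (IsStarProjection.one A).norm_le
    linarith
  have hvs : star v = v := by
    have h1 : star v * (f * y * f + e) = 1 := by
      simpa [hfs, hes, hys, mul_assoc] using congrArg star hDv
    calc star v = star v * ((f * y * f + e) * v) := by rw [hDv, mul_one]
      _ = v := by rw [← mul_assoc, h1, one_mul]
  have hfv : f * v = v * f := by rw [hf, sub_mul, mul_sub, hev, hve]; simp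
  obtain ⟨a, ha⟩ : ∃ a, a = e * y * e := ⟨_, rfl⟩
  obtain ⟨b, hb⟩ : ∃ b, b = e * y * f := ⟨_, rfl⟩
  obtain ⟨g, hg⟩ : ∃ g, g = f * y * f := ⟨_, rfl⟩
  obtain ⟨d, hd⟩ : ∃ d, d = v * f := ⟨_, rfl⟩
  have hbs : star b = f * y * e := by simp [hb, hes, hfs, hys, mul_assoc]
  have hds : star d = d := by rw [hd, star_mul, hvs, hfs, hfv]
  have hyd : y = a + b + star b + g := by
    calc y = (e + f) * y * (e + f) := by rw [hsum]; simp
      _ = _ := by rw [hbs, ha, hb, hg]; noncomm_ring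
  have hda : d * a = 0 := by rw [hd, ha, mul_assoc v]; simp [← mul_assoc, hfe]
  have hdb : d * b = 0 := by rw [hd, hb]; simp [← mul_assoc, mul_assoc v, hfe]
  have hed : e * d = 0 := by rw [hd, ← hfv, ← mul_assoc, hef, zero_mul]
  have had : a * d = 0 := by rw [ha, mul_assoc, hed, mul_zero]
  have hbd : star b * d = 0 := by rw [hbs, mul_assoc, hed, mul_zero]
  have hdg : d * g = f := by
    have : v * g = f := by
      have h1 := hvD
      rw [mul_add, hve, ← hsum, ← hg, add_comm e f] at h1
      exact add_right_cancel h1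
    rw [hd, mul_assoc, show f * g = g by rw [hg, ← mul_assoc, ← mul_assoc, hff], this]
  have hgd : g * d = f := by
    have hgs : star g = g := by simp [hg, hfs, hys, mul_assoc]
    simpa [hds, hgs, hfs] using congrArg star hdg
  have hbf : b * f = b := by rw [hb, mul_assoc, hff]
  have hfb : f * star b = star b := by rw [hbs, ← mul_assoc, ← mul_assoc, hff]
  have hLu : IsUnit (1 - b * d) := by
    have h0 : b * d * (b * d) = 0 := by
      rw [mul_assoc, ← mul_assoc d, hdb, zero_mul, mul_zero]
    refine ⟨⟨1 - b * d, 1 + b * d, ?_, ?_⟩, rfl⟩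
    · rw [mul_add, sub_mul, sub_mul, h0]; simp
    · rw [mul_sub, add_mul, add_mul, h0]; simp
  have hz : (1 - b * d) * y * star (1 - b * d) = a + g - b * d * star b := by
    have h1 : (1 - b * d) * y = a + star b + g - b * d * star b := by
      calc (1 - b * d) * y
          = a + b + star b + g - b * (d * a) - b * (d * b) - b * d * star b - b * (d * g) := by
            conv_lhs => rw [hyd]
            noncomm_ring
        _ = _ := by rw [hda, hdb, hdg, hbf]; simp; abel
    calc (1 - b * d) * y * star (1 - b * d)
        = a + star b + g - b * d * star b - (a * d) * star b - (star b * d) * star b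
          - (g * d) * star b + b * d * (star b * d) * star b := by
          rw [h1, star_sub, star_mul, star_one, hds]
          noncomm_ring
      _ = _ := by rw [had, hbd, hgd, hfb]; simp; abel
  refine ⟨(1 - b * d) * y * star (1 - b * d), ?_, ?_, ?_, ?_⟩
  · exact hy.conjugate _
  · exact (hLu.mul hyu).mul hLu.star
  · rw [hz]
    have h1 : (a + g - b * d * star b) * e = a - b * d * star b := by
      rw [ha, hg, hbs, sub_mul, add_mul]
      simp only [mul_assoc, hee, hfe, mul_zero, add_zero]
    have h2 : e * (a + g - b * d * star b) = a - b * d * star b := by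
      rw [ha, hg, hb, mul_sub, mul_add]
      simp only [← mul_assoc, hee, hef, zero_mul, add_zero]
    rw [commute_iff_eq, h1, h2]
  · rw [hz]
    have hxd : x = e * x * e + f * x * f := by
      calc x = (e + f) * x * (e + f) := by rw [hsum]; simp
        _ = e * x * e + e * x * f + (f * x) * e + f * x * f := by noncomm_ring
        _ = _ := by rw [hexf, hfx, hfe]; simp
    have hbx : b = e * (y - x) * f := by rw [hb, mul_sub, sub_mul, hexf, sub_zero]
    have hbn : ‖b‖ ≤ ‖y - x‖ := hbx ▸ hcomp _ hne hnf
    have hyx : ‖y - x‖ = ‖x - y‖ := norm_sub_rev _ _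
    have hdn : ‖d‖ ≤ 2 := by
      calc ‖d‖ ≤ ‖v‖ * ‖f‖ := hd ▸ norm_mul_le _ _
        _ ≤ 2 * 1 := by gcongr
        _ = 2 := by norm_num
    have hbdb : ‖b * d * star b‖ ≤ 2 * ‖x - y‖ := by
      calc ‖b * d * star b‖ ≤ ‖b‖ * ‖d‖ * ‖star b‖ := norm_mul₃_le
        _ = ‖b‖ * ‖d‖ * ‖b‖ := by rw [norm_star]
        _ ≤ ‖x - y‖ * 2 * 1 := by gcongr <;> linarith
        _ = _ := by ring
    calc ‖a + g - b * d * star b - x‖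
        = ‖e * (y - x) * e + f * (y - x) * f - b * d * star b‖ := by
          conv_lhs => rw [hxd]
          rw [ha, hg]; congr 1; noncomm_ring
      _ ≤ ‖e * (y - x) * e‖ + ‖f * (y - x) * f‖ + ‖b * d * star b‖ :=
          (norm_sub_le _ _).trans (by gcongr; exact norm_add_le _ _)
      _ ≤ ‖y - x‖ + ‖y - x‖ + 2 * ‖x - y‖ := by
          gcongr
          · exact hcomp _ hne hne
          · exact hcomp _ hnf hnf
      _ < η := by linarith

/-- The positive spectral projection `h` of an invertible self-adjoint element `z`, together with
a factorization of `h - z - 1/2` through `1/4 - z²`. -/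
lemma IsSelfAdjoint.exists_positive_spectral_projection {z : A} (hz : IsSelfAdjoint z)
    (hzu : IsUnit z) :
    ∃ h G : A, IsStarProjection h ∧ ‖G‖ ≤ 2 ∧
      h - (z + (1 / 2 : ℝ) • 1) = G * ((1 / 4 : ℝ) • 1 - z * z) ∧
      ∀ w : A, Commute z w → Commute h w := by
  have h0 : ∀ t ∈ spectrum ℝ z, t ≠ 0 := fun t ht ht0 =>
    spectrum.zero_notMem ℝ hzu (ht0 ▸ ht)
  let χ : ℝ → ℝ := fun t => if 0 < t then 1 else 0
  let γ : ℝ → ℝ := fun t => (2 * χ t - 1) / (1 / 2 + |t|)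
  have hχ : ContinuousOn χ (spectrum ℝ z) := by
    intro t ht
    refine ContinuousAt.continuousWithinAt ?_
    rcases lt_or_gt_of_ne (h0 t ht) with ht | ht
    · refine (continuousAt_const (y := (0 : ℝ))).congr ?_
      filter_upwards [Iio_mem_nhds ht] with s hs
      simp [χ, not_lt.mpr (Set.mem_Iio.mp hs).le]
    · refine (continuousAt_const (y := (1 : ℝ))).congr ?_
      filter_upwards [Ioi_mem_nhds ht] with s hs
      simp [χ, Set.mem_Ioi.mp hs]
  have hγ : ContinuousOn γ (spectrum ℝ z) := by
    refine ContinuousOn.div (by fun_prop) (by fun_prop) fun t _ => ?_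
    positivity
  refine ⟨cfc χ z, cfc γ z, ⟨?_, cfc_predicate χ z⟩, ?_, ?_, fun w hw => hw.cfc_real χ⟩
  · rw [IsIdempotentElem, ← cfc_mul χ χ z]
    refine cfc_congr fun t _ => ?_
    simp [χ]
  · refine norm_cfc_le (by norm_num) fun t _ => ?_
    have hp : 0 < 1 / 2 + |t| := by positivity
    rw [Real.norm_eq_abs, abs_div, abs_of_pos hp, div_le_iff₀ hp]
    have : |2 * χ t - 1| = 1 := by by_cases ht : 0 < t <;> norm_num [χ, ht]
    rw [this]
    linarith [abs_nonneg t]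
  · have h1 : z + (1 / 2 : ℝ) • 1 = cfc (fun t : ℝ => t + 1 / 2) z := by
      rw [cfc_add_const (1 / 2 : ℝ) (fun t => t) z, cfc_id' ℝ z, Algebra.algebraMap_eq_smul_one]
    have h2 : (1 / 4 : ℝ) • 1 - z * z = cfc (fun t : ℝ => 1 / 4 - t * t) z := by
      rw [cfc_sub (fun _ : ℝ => 1 / 4) (fun t => t * t) z, cfc_const (1 / 4 : ℝ) z,
        cfc_mul (fun t : ℝ => t) (fun t => t) z, cfc_id' ℝ z, Algebra.algebraMap_eq_smul_one]
    rw [h1, h2, ← cfc_sub χ _ z, ← cfc_mul γ _ z]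
    refine cfc_congr fun t ht => ?_
    have hp : 1 / 2 + |t| ≠ 0 := by positivity
    simp only [γ]
    field_simp
    rcases lt_or_gt_of_ne (h0 t ht) with ht | ht
    · simp [χ, not_lt.mpr ht.le, abs_of_neg ht]; ring
    · simp [χ, ht, abs_of_pos ht]; ring

variable [PartialOrder A] [StarOrderedRing A]

/-- In a C*-algebra of real rank zero, a self-adjoint contraction `c` in a corner `eAe` is, up to
`η`, as close to a projection of `eAe` as twice its defect `c - c²`, in all trace seminorms. -/
lemma RealRankZero.exists_isStarProjection_near (hA : RealRankZero A) {e c : A}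
    (he : IsStarProjection e) (hc : IsSelfAdjoint c) (hce : c * e = c) (hc1 : ‖c‖ ≤ 1)
    {η : ℝ} (hη : 0 < η) (hη1 : η ≤ 1) :
    ∃ q : A, IsStarProjection q ∧ q * e = q ∧ e * q = q ∧
      ∀ τ : A →ₗ[ℂ] ℂ, IsTracialState τ →
        traceSeminorm τ (q - c) ≤ 2 * traceSeminorm τ (c - c * c) + 9 * η := by
  have hee : e * e = e := he.isIdempotentElem
  have hes : star e = e := he.isSelfAdjoint
  have hne : ‖e‖ ≤ 1 := he.norm_le
  obtain ⟨x, hx⟩ : ∃ x, x = c - (1 / 2 : ℝ) • e + (1 - e) := ⟨_, rfl⟩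
  have hxs : IsSelfAdjoint x := by
    simp [IsSelfAdjoint, hx, hc.star_eq, hes]
  have hxe : x * e = c - (1 / 2 : ℝ) • e := by
    simp [hx, add_mul, sub_mul, hce, hee]
  obtain ⟨z, hzs, hzu, hze, hzx⟩ := hA.exists_isUnit_commute_s8 he hxs
    (by rw [mul_sub, mul_one, hxe, hx]; abel) hη
  obtain ⟨h, G, hh, hG, hhG, hhc⟩ := hzs.exists_positive_spectral_projection hzu
  have hhe : h * e = e * h := hhc e hze
  have hhh : h * h = h := hh.isIdempotentElem
  obtain ⟨r, hr⟩ : ∃ r, r = (z - x) * e := ⟨_, rfl⟩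
  have hrn : ‖r‖ ≤ η := by
    calc ‖r‖ ≤ ‖z - x‖ * ‖e‖ := hr ▸ norm_mul_le _ _
      _ ≤ η * 1 := by gcongr
      _ = η := mul_one _
  have hcr : (z + (1 / 2 : ℝ) • 1) * e = c + r := by
    rw [hr, sub_mul, hxe, add_mul, smul_mul_assoc, one_mul]; abel
  have her : e * (c + r) = c + r := by
    rw [← hcr, ← mul_assoc, mul_add, ← hze.eq, add_mul, add_mul, mul_assoc, hee]
    simp [hee]
  have hdef : ((1 / 4 : ℝ) • 1 - z * z) * e = (c + r) - (c + r) * (c + r) := by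
    have h1 : (c + r) * (c + r) = (z + (1 / 2 : ℝ) • 1) * (z + (1 / 2 : ℝ) • 1) * e := by
      calc (c + r) * (c + r) = (z + (1 / 2 : ℝ) • 1) * (e * (c + r)) := by
            rw [← mul_assoc, hcr]
        _ = _ := by rw [her, ← hcr, mul_assoc]
    rw [h1, ← hcr, ← sub_mul]
    congr 1
    simp only [mul_add, add_mul, smul_mul_assoc, mul_smul_comm, one_mul, mul_one]
    module
  refine ⟨h * e, ⟨?_, ?_⟩, ?_, ?_, fun τ hτ => ?_⟩
  · rw [IsIdempotentElem, mul_assoc, ← mul_assoc e, ← hhe, mul_assoc h e, hee, ← mul_assoc, hhh]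
  · rw [IsSelfAdjoint, star_mul, hes, hh.isSelfAdjoint.star_eq, hhe]
  · rw [mul_assoc, hee]
  · rw [hhe, ← mul_assoc, hee]
  · have hq : h * e - c = G * ((c - c * c) + (r - c * r - r * c - r * r)) + r := by
      have h2 := congrArg (· * e) hhG
      simp only [sub_mul h, hcr, mul_assoc, hdef] at h2
      rw [← sub_eq_iff_eq_add, sub_sub, h2]
      congr 1
      noncomm_ring
    have h3 : ‖r - c * r - r * c - r * r‖ ≤ 4 * η := by
      have hcr' : ‖c * r‖ ≤ 1 * η := (norm_mul_le _ _).trans (by gcongr)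
      have hrc' : ‖r * c‖ ≤ η * 1 := (norm_mul_le _ _).trans (by gcongr)
      have hrr : ‖r * r‖ ≤ η * 1 := (norm_mul_le _ _).trans (by gcongr; exact hrn.trans hη1)
      linarith [norm_sub_le (r - c * r - r * c) (r * r), norm_sub_le (r - c * r) (r * c),
        norm_sub_le r (c * r)]
    have h4 := (hτ.traceSeminorm_le_norm _).trans h3
    have h5 := (hτ.traceSeminorm_le_norm _).trans hrn
    have h6 : traceSeminorm τ (G * ((c - c * c) + (r - c * r - r * c - r * r))) ≤
        2 * (traceSeminorm τ (c - c * c) + 4 * η) := by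
      refine (hτ.traceSeminorm_mul_le_left _ _).trans ?_
      gcongr
      · exact traceSeminorm_nonneg τ _
      · exact (hτ.traceSeminorm_add_le _ _).trans (by gcongr)
    rw [hq]
    linarith [hτ.traceSeminorm_add_le
      (G * ((c - c * c) + (r - c * r - r * c - r * r))) r]

/-- If a projection `p` almost commutes with a projection `e` in the trace seminorm, then `e p e` is
almost idempotent. -/
lemma IsTracialState.traceSeminorm_compression_sub_sq_le {τ : A →ₗ[ℂ] ℂ} (hτ : IsTracialState τ)
    {e p : A} (he : IsStarProjection e) (hp : IsStarProjection p) :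
    traceSeminorm τ (e * p * e - e * p * e * (e * p * e)) ≤ traceSeminorm τ (p * e - e * p) := by
  have hee : e * e = e := he.isIdempotentElem
  have hpp : p * p = p := hp.isIdempotentElem
  have h1 : e * p * e - e * p * e * (e * p * e) = e * p * (1 - e) * (p * e - e * p) * 1 := by
    have h0 : (1 - e) * e = 0 := he.one_sub_mul_self
    calc _ = e * (p * p) * e - e * p * (e * e) * p * e := by rw [hpp]; noncomm_ring
      _ = e * p * (1 - e) * p * e - e * p * ((1 - e) * e) * p := by
        rw [hee, h0]; noncomm_ring
      _ = _ := by noncomm_ring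
  rw [h1]
  refine hτ.traceSeminorm_mul_le_of_norm_le_one ?_ (IsStarProjection.one A).norm_le
  calc ‖e * p * (1 - e)‖ ≤ ‖e‖ * ‖p‖ * ‖1 - e‖ := norm_mul₃_le
    _ ≤ 1 * 1 * 1 := by
      gcongr
      exacts [he.norm_le, hp.norm_le, he.one_sub.norm_le]
    _ = 1 := by norm_num

end Corner

/-- For every `ε > 0` and `n ∈ ℕ` there is `δ > 0` such that: if `A` is a
unital C*-algebra with real rank zero, `T` is a set of tracial states on `A`,
`(e_{j,k})_{1 ≤ j,k ≤ n}` is a system of matrix units in `A` with identity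
`e = Σ_k e_{k,k}`, and `p` is a projection with `p ≤ e` which commutes with each `e_{j,k}`
up to `δ` in each `‖·‖_{2,τ}` for `τ ∈ T`, then there is a projection `q ≤ e` commuting with
every `e_{j,k}` with `‖q − p‖_{2,τ} < ε` for all `τ ∈ T`. -/
theorem exists_commuting_projection_matrix_units (ε : ℝ) (hε : 0 < ε) (n : ℕ) :
    ∃ δ > (0 : ℝ), ∀ (A : Type*) [CStarAlgebra A] [PartialOrder A] [StarOrderedRing A],
      RealRankZero A → ∀ (T : Set (A →ₗ[ℂ] ℂ)), (∀ τ ∈ T, IsTracialState τ) →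
      ∀ e : Fin n → Fin n → A,
        (∀ j k, star (e j k) = e k j) →
        (∀ i j k l, e i j * e k l = if j = k then e i l else 0) →
        (∀ i j, e i j ≠ 0) →
        ∀ p : A, IsProjection p → p ≤ ∑ k, e k k →
        (∀ j k, ∀ τ ∈ T, traceSeminorm τ (p * e j k - e j k * p) < δ) →
        ∃ q : A, IsProjection q ∧ q ≤ ∑ k, e k k ∧
          (∀ j k, q * e j k = e j k * q) ∧
          ∀ τ ∈ T, traceSeminorm τ (q - p) < ε := by
  
  obtain ⟨δ, hδ⟩ : ∃ δ, δ = min 1 (ε / (12 * n + 1)) := ⟨_, rfl⟩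
  have hδ0 : 0 < δ := by rw [hδ]; positivity
  have hδ1 : δ ≤ 1 := hδ ▸ min_le_left _ _
  have hδε : n * (12 * δ) < ε := by
    have h1 : δ ≤ ε / (12 * n + 1) := hδ ▸ min_le_right _ _
    rw [le_div_iff₀ (by positivity)] at h1
    linarith
  refine ⟨δ, hδ0, fun A _ _ _ hA T hT e hes hem _ p hp hpe hpδ => ?_⟩
  have hps := isProjection_iff_isStarProjection.mp hp
  rcases Nat.eq_zero_or_pos n with rfl | hn
  · have hp0 : p = 0 := le_antisymm (by simpa using hpe) hps.nonneg
    subst hp0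
    exact ⟨0, hp, by simp, by simp, fun τ _ => by simpa [traceSeminorm] using hε⟩
  let o : Fin n := ⟨0, hn⟩
  have hdiag : ∀ k, IsStarProjection (e k k) := fun k =>
    ⟨by simp [IsIdempotentElem, hem], hes k k⟩
  have hnorm : ∀ j k, ‖e j k‖ ≤ 1 := by
    intro j k
    have h1 : ‖e j k‖ * ‖e j k‖ = ‖e k k‖ := by
      rw [← CStarRing.norm_star_mul_self, hes, hem, if_pos rfl]
    nlinarith [(hdiag k).norm_le, norm_nonneg (e j k)]
  have hE : IsStarProjection (∑ k, e k k) := by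
    refine ⟨?_, ?_⟩
    · simp [IsIdempotentElem, Finset.sum_mul, Finset.mul_sum, hem]
    · simp [IsSelfAdjoint, hes]
  have hpE : p * ∑ k, e k k = p := (hps.le_iff_mul_eq_left hE).mp hpe
  obtain ⟨c, hc⟩ : ∃ c, c = e o o * p * e o o := ⟨_, rfl⟩
  have hcs : IsSelfAdjoint c := by
    simp [IsSelfAdjoint, hc, hes, hps.isSelfAdjoint.star_eq, mul_assoc]
  have hcn : ‖c‖ ≤ 1 := by
    calc ‖c‖ ≤ ‖e o o‖ * ‖p‖ * ‖e o o‖ := hc ▸ norm_mul₃_le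
      _ ≤ 1 * 1 * 1 := by gcongr; exacts [hnorm o o, hps.norm_le, hnorm o o]
      _ = 1 := by norm_num
  obtain ⟨q, hq, hqe, heq, hqτ⟩ := hA.exists_isStarProjection_near (hdiag o) hcs
    (by rw [hc, mul_assoc, hem, if_pos rfl]) hcn hδ0 hδ1
  have hqq : q * q = q := hq.isIdempotentElem
  have hleft : ∀ j k, (∑ i, e i o * q * e o i) * e j k = e j o * q * e o k := by
    intro j k
    simp [Finset.sum_mul, mul_assoc, hem]
  have hright : ∀ j k, e j k * (∑ i, e i o * q * e o i) = e j o * q * e o k := by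
    intro j k
    simp [Finset.mul_sum, ← mul_assoc, hem]
  have hQ : IsStarProjection (∑ i, e i o * q * e o i) := by
    refine ⟨?_, ?_⟩
    · rw [IsIdempotentElem]
      rw [Finset.mul_sum]
      refine Finset.sum_congr rfl fun i _ => ?_
      calc (∑ i, e i o * q * e o i) * (e i o * q * e o i)
          = e i o * q * (e o o * q) * e o i := by
            rw [← mul_assoc, ← mul_assoc, hleft]; noncomm_ring
        _ = _ := by rw [heq, mul_assoc (e i o), hqq]
    · simp [IsSelfAdjoint, hes, hq.isSelfAdjoint.star_eq, mul_assoc]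
  refine ⟨∑ i, e i o * q * e o i, isProjection_iff_isStarProjection.mpr hQ, ?_, fun j k => ?_,
    fun τ hτT => ?_⟩
  · rw [hQ.le_iff_mul_eq_left hE, Finset.mul_sum]
    exact Finset.sum_congr rfl fun i _ => hleft i i
  · rw [hleft, hright]
  · have hτ := hT τ hτT
    have hcc : traceSeminorm τ (c - c * c) ≤ δ :=
      (hc ▸ hτ.traceSeminorm_compression_sub_sq_le (hdiag o) hps).trans (hpδ o o τ hτT).le
    have hqc := hqτ τ hτ
    have hterm : ∀ i, e i o * q * e o i - p * e i i =
        e i o * (q - c) * e o i - 1 * (p * e i o - e i o * p) * e o i := by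
      intro i
      have h1 : e i o * c * e o i = e i o * p * e o i := by
        calc e i o * c * e o i = (e i o * e o o) * p * (e o o * e o i) := by
              rw [hc]; noncomm_ring
          _ = _ := by simp [hem]
      have h2 : p * e i o * e o i = p * e i i := by rw [mul_assoc, hem, if_pos rfl]
      rw [mul_sub, sub_mul, h1, one_mul, sub_mul, h2]
      abel
    have hbound : ∀ i, traceSeminorm τ (e i o * q * e o i - p * e i i) ≤ 12 * δ := by
      intro i
      rw [hterm]
      have h1 := hτ.traceSeminorm_mul_le_of_norm_le_one (x := q - c) (hnorm i o) (hnorm o i)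
      have h2 := hτ.traceSeminorm_mul_le_of_norm_le_one (x := p * e i o - e i o * p)
        (IsStarProjection.one A).norm_le (hnorm o i)
      linarith [hτ.traceSeminorm_sub_le (e i o * (q - c) * e o i)
        (1 * (p * e i o - e i o * p) * e o i), hpδ i o τ hτT]
    calc traceSeminorm τ (∑ i, e i o * q * e o i - p)
        = traceSeminorm τ (∑ i, (e i o * q * e o i - p * e i i)) := by
          rw [Finset.sum_sub_distrib, ← Finset.mul_sum, hpE]
      _ ≤ ∑ i, traceSeminorm τ (e i o * q * e o i - p * e i i) := hτ.traceSeminorm_sum_le _ _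
      _ ≤ ∑ _i : Fin n, 12 * δ := Finset.sum_le_sum fun i _ => hbound i
      _ = n * (12 * δ) := by simp
      _ < ε := hδε
end

section
/- Let H be a complex Hilbert space, and let A ⊆ B(H) be a norm-closed unital *-subalgebra of the bounded operators on H (containing the identity operator) which, as a unital C*-algebra, has real rank zero. Let p ∈ A'' be a projection in the double commutant of A. Then p is a limit of projections in A in the strong operator topology; that is, for every ε > 0 and all finitely many vectors ξ₁, …, ξ_m ∈ H there exists a projection q ∈ A with ‖q ξᵢ − p ξᵢ‖ < ε for 1 ≤ i ≤ m. -/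
open scoped InnerProductSpace

/-- A real-linear version of the bipolar theorem: in a complex Hilbert space, a point lies in the
closure of a real subspace as soon as it is annihilated by the real parts of all functionals
whose real parts annihilate the subspace. -/
lemma mem_closure_of_forall_re_inner_eq_zero {E : Type*}
    [NormedAddCommGroup E] [InnerProductSpace ℂ E] [CompleteSpace E] (M : AddSubgroup E)
    (hM : ∀ (r : ℝ), ∀ u ∈ M, (r : ℂ) • u ∈ M) (v : E)
    (hv : ∀ w : E, (∀ u ∈ M, (⟪w, u⟫_ℂ).re = 0) → (⟪w, v⟫_ℂ).re = 0) :
    v ∈ closure (M : Set E) := by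
  let : InnerProductSpace ℝ E := InnerProductSpace.rclikeToReal ℂ E
  let N : Submodule ℝ E := { M with smul_mem' := fun r u hu => hM r u hu }
  have h : v ∈ Nᗮᗮ := by
    rw [Submodule.mem_orthogonal]
    intro w hw
    refine hv w fun u hu => ?_
    have := (Submodule.mem_orthogonal' N w).1 hw u hu
    exact this
  rw [Submodule.orthogonal_orthogonal_eq_closure] at h
  exact h

namespace ContinuousLinearMap

variable {H : Type*} [NormedAddCommGroup H] [InnerProductSpace ℂ H]
  {ι : Type*} [Fintype ι]

/-- The diagonal action of an operator on a finite Hilbert sum of copies of the space. -/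
def ampliation (ι : Type*) [Fintype ι] (a : H →L[ℂ] H) :
    PiLp 2 (fun _ : ι => H) →L[ℂ] PiLp 2 (fun _ : ι => H) :=
  (PiLp.continuousLinearEquiv 2 ℂ (fun _ : ι => H)).symm.toContinuousLinearMap ∘L
    ContinuousLinearMap.pi fun i => a ∘L PiLp.proj 2 (fun _ : ι => H) i

@[simp]
lemma ampliation_apply (a : H →L[ℂ] H) (v : PiLp 2 (fun _ : ι => H)) (i : ι) :
    ampliation ι a v i = a (v i) := rfl

lemma inner_ampliation_star [CompleteSpace H] (a : H →L[ℂ] H) (v w : PiLp 2 (fun _ : ι => H)) :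
    ⟪ampliation ι (star a) v, w⟫_ℂ = ⟪v, ampliation ι a w⟫_ℂ := by
  simp [PiLp.inner_apply, ContinuousLinearMap.star_eq_adjoint,
    ContinuousLinearMap.adjoint_inner_left]

/-- If an operator on a finite Hilbert sum commutes with the diagonal action of `S`, then it
commutes with the diagonal action of the double commutant of `S`. -/
lemma commute_ampliation_of_mem_centralizer_centralizer {S : Set (H →L[ℂ] H)}
    {T : PiLp 2 (fun _ : ι => H) →L[ℂ] PiLp 2 (fun _ : ι => H)}
    (hT : ∀ a ∈ S, Commute (ampliation ι a) T) {x : H →L[ℂ] H}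
    (hx : x ∈ Set.centralizer (Set.centralizer S)) : Commute (ampliation ι x) T := by
  classical
  let inc (j : ι) : H →L[ℂ] PiLp 2 (fun _ : ι => H) :=
    (PiLp.continuousLinearEquiv 2 ℂ (fun _ : ι => H)).symm.toContinuousLinearMap ∘L
      ContinuousLinearMap.single ℂ (fun _ : ι => H) j
  have hinc (j : ι) (u : H) : inc j u = PiLp.single 2 j u := rfl
  have amp_inc (a : H →L[ℂ] H) (j : ι) (u : H) :
      ampliation ι a (inc j u) = inc j (a u) := by
    ext i
    rcases eq_or_ne i j with rfl | h <;> simp [*]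
  have sum_inc (v : PiLp 2 (fun _ : ι => H)) : v = ∑ j, inc j (v j) := by
    ext i
    simp [hinc, Finset.sum_pi_single]
  let entry (i j : ι) : H →L[ℂ] H := PiLp.proj 2 (fun _ : ι => H) i ∘L T ∘L inc j
  have hentry (i j : ι) : entry i j ∈ Set.centralizer S := by
    intro a ha
    ext u
    have := congrArg (fun B => B (inc j u) i) (hT a ha).eq
    simpa [entry, amp_inc] using this
  ext v i
  have key (j : ι) (u : H) : x (T (inc j u) i) = T (inc j (x u)) i :=
    (DFunLike.congr_fun (hx _ (hentry i j)) u).symm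
  change x (T v i) = T (ampliation ι x v) i
  rw [sum_inc v]
  simp only [map_sum, amp_inc, WithLp.ofLp_sum, Finset.sum_apply, key]

variable [CompleteSpace H]

/-- Von Neumann's double commutant theorem, for finitely many vectors. -/
lemma ampliation_mem_closure_of_mem_centralizer_centralizer (S : StarSubalgebra ℂ (H →L[ℂ] H))
    {x : H →L[ℂ] H} (hx : x ∈ Set.centralizer (Set.centralizer (S : Set (H →L[ℂ] H))))
    (ξ : PiLp 2 (fun _ : ι => H)) :
    ampliation ι x ξ ∈ closure {v | ∃ a ∈ S, v = ampliation ι a ξ} := by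
  let M : Submodule ℂ (PiLp 2 (fun _ : ι => H)) :=
    { carrier := {v | ∃ a ∈ S, v = ampliation ι a ξ}
      zero_mem' := ⟨0, zero_mem S, by ext; simp⟩
      add_mem' := by
        rintro _ _ ⟨a, ha, rfl⟩ ⟨b, hb, rfl⟩
        exact ⟨a + b, add_mem ha hb, by ext; simp⟩
      smul_mem' := by
        rintro c _ ⟨a, ha, rfl⟩
        exact ⟨c • a, SMulMemClass.smul_mem c ha, by ext; simp⟩ }
  let K := M.topologicalClosure
  have : CompleteSpace K := M.isClosed_topologicalClosure.completeSpace_coe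
  have hK : ∀ a ∈ S, ∀ v ∈ K, ampliation ι a v ∈ K := by
    intro a ha v hv
    refine map_mem_closure (ampliation ι a).continuous hv ?_
    rintro _ ⟨b, hb, rfl⟩
    exact ⟨a * b, mul_mem ha hb, by ext; simp⟩
  have hKo : ∀ a ∈ S, ∀ v ∈ Kᗮ, ampliation ι a v ∈ Kᗮ := by
    intro a ha v hv
    rw [Submodule.mem_orthogonal]
    intro u hu
    rw [← inner_ampliation_star]
    exact (Submodule.mem_orthogonal _ _).1 hv _ (hK _ (star_mem ha) u hu)
  have hP : ∀ a ∈ S, Commute (ampliation ι a) K.starProjection := by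
    intro a ha
    ext1 v
    symm
    refine Submodule.eq_starProjection_of_mem_orthogonal
      (hK a ha _ (Submodule.starProjection_apply_mem K v)) ?_
    have h := hKo a ha _ (Submodule.sub_starProjection_mem_orthogonal (K := K) v)
    rwa [map_sub] at h
  have hξ : ξ ∈ K := subset_closure ⟨1, one_mem S, by ext; simp⟩
  have h := DFunLike.congr_fun (commute_ampliation_of_mem_centralizer_centralizer hP hx).eq ξ
  change ampliation ι x (K.starProjection ξ) = K.starProjection (ampliation ι x ξ) at h
  rw [Submodule.starProjection_eq_self_iff.2 hξ] at h
  have h' : ampliation ι x ξ ∈ K := Submodule.starProjection_eq_self_iff.1 h.symm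
  exact h'

/-- Self-adjoint elements of the double commutant are strong limits of self-adjoint elements. -/
lemma ampliation_mem_closure_isSelfAdjoint (S : StarSubalgebra ℂ (H →L[ℂ] H))
    {x : H →L[ℂ] H} (hx : x ∈ Set.centralizer (Set.centralizer (S : Set (H →L[ℂ] H))))
    (hsa : IsSelfAdjoint x) (ξ : PiLp 2 (fun _ : ι => H)) :
    ampliation ι x ξ ∈ closure {v | ∃ a ∈ S, IsSelfAdjoint a ∧ v = ampliation ι a ξ} := by
  let M : AddSubgroup (PiLp 2 (fun _ : ι => H)) :=
    { carrier := {v | ∃ a ∈ S, IsSelfAdjoint a ∧ v = ampliation ι a ξ}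
      zero_mem' := ⟨0, zero_mem S, .zero _, by ext; simp⟩
      add_mem' := by
        rintro _ _ ⟨a, ha, ha', rfl⟩ ⟨b, hb, hb', rfl⟩
        exact ⟨a + b, add_mem ha hb, ha'.add hb', by ext; simp⟩
      neg_mem' := by
        rintro _ ⟨a, ha, ha', rfl⟩
        exact ⟨-a, neg_mem ha, ha'.neg, by ext; simp⟩ }
  refine mem_closure_of_forall_re_inner_eq_zero M ?_ _ fun w hw => ?_
  · rintro r _ ⟨a, ha, ha', rfl⟩
    refine ⟨(r : ℂ) • a, SMulMemClass.smul_mem _ ha, ?_, by ext; simp⟩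
    rw [IsSelfAdjoint, star_smul, ha'.star_eq]
    simp
  · let η : PiLp 2 (fun _ : ι ⊕ ι => H) := WithLp.toLp 2 (Sum.elim ξ w)
    let f : PiLp 2 (fun _ : ι ⊕ ι => H) → ℝ := fun v =>
      (∑ i, ⟪w i, v (.inl i)⟫_ℂ).re + (∑ i, ⟪v (.inr i), ξ i⟫_ℂ).re
    have hf : Continuous f := by fun_prop
    have hfa (a : H →L[ℂ] H) : f (ampliation _ a η) =
        (⟪w, ampliation ι (a + star a) ξ⟫_ℂ).re := by
      simp [f, η, PiLp.inner_apply, inner_add_right, Finset.sum_add_distrib,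
        ContinuousLinearMap.star_eq_adjoint, ContinuousLinearMap.adjoint_inner_right]
    have h0 : f (ampliation _ x η) ∈ ({0} : Set ℝ) := by
      have := map_mem_closure hf (ampliation_mem_closure_of_mem_centralizer_centralizer S hx η)
        (t := {0}) ?_
      · simpa using this
      · rintro _ ⟨a, ha, rfl⟩
        rw [Set.mem_singleton_iff, hfa]
        exact hw _ ⟨_, add_mem ha (star_mem ha), .add_star_self a, rfl⟩
    rw [Set.mem_singleton_iff, hfa, hsa.star_eq] at h0
    have : ampliation ι (x + x) ξ = ampliation ι x ξ + ampliation ι x ξ := by ext; simp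
    rw [this, inner_add_right, Complex.add_re] at h0
    linarith

lemma exists_isSelfAdjoint_norm_apply_sub_lt (S : StarSubalgebra ℂ (H →L[ℂ] H))
    {x : H →L[ℂ] H} (hx : x ∈ Set.centralizer (Set.centralizer (S : Set (H →L[ℂ] H))))
    (hsa : IsSelfAdjoint x) (ξ : ι → H) {ε : ℝ} (hε : 0 < ε) :
    ∃ a ∈ S, IsSelfAdjoint a ∧ ∀ i, ‖a (ξ i) - x (ξ i)‖ < ε := by
  obtain ⟨_, ⟨a, ha, ha', rfl⟩, h⟩ := Metric.mem_closure_iff.1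
    (ampliation_mem_closure_isSelfAdjoint S hx hsa (WithLp.toLp 2 ξ)) ε hε
  refine ⟨a, ha, ha', fun i => lt_of_le_of_lt ?_ h⟩
  rw [dist_comm, dist_eq_norm]
  exact PiLp.norm_apply_le (ampliation ι a (WithLp.toLp 2 ξ) - ampliation ι x (WithLp.toLp 2 ξ)) i

/-- The positive spectral projection of an invertible self-adjoint operator. -/
lemma exists_positive_spectral_projection (S : StarSubalgebra ℂ (H →L[ℂ] H))
    (hclosed : IsClosed (S : Set (H →L[ℂ] H))) {b : H →L[ℂ] H} (hbS : b ∈ S)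
    (hb : IsSelfAdjoint b) (hu : IsUnit b) :
    ∃ q ∈ S, IsStarProjection q ∧ 0 ≤ q * b ∧ 0 ≤ (1 - q) * (-b) := by
  let f : ℝ → ℝ := fun t => if 0 < t then 1 else 0
  have hf : ContinuousOn f (spectrum ℝ b) := by
    intro t ht
    have ht0 : t ≠ 0 := by
      rintro rfl
      exact spectrum.zero_notMem ℝ hu ht
    refine ContinuousAt.continuousWithinAt ?_
    rcases lt_or_gt_of_ne ht0 with h | h
    · refine continuousAt_const.congr (f := fun _ => (0 : ℝ)) ?_
      filter_upwards [eventually_lt_nhds h] with s hs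
      simp [f, hs.le]
    · refine continuousAt_const.congr (f := fun _ => (1 : ℝ)) ?_
      filter_upwards [eventually_gt_nhds h] with s hs
      simp [f, hs]
  have : IsClosed (S : Set (H →L[ℂ] H)) := hclosed
  have hid : cfc (fun t : ℝ => t) b = b := cfc_id' ℝ b
  refine ⟨cfc f b, cfc_mem f hbS, ⟨?_, cfc_predicate f b⟩, ?_, ?_⟩
  · rw [IsIdempotentElem, ← cfc_mul f f b]
    congr 1
    ext t
    simp [f]
  · nth_rw 2 [← hid]
    rw [← cfc_mul f _ b]
    refine cfc_nonneg fun t _ => ?_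
    simp only [f]
    split_ifs with h
    · simpa using h.le
    · simp
  · nth_rw 2 [← hid]
    rw [← cfc_one ℝ b, ← cfc_sub _ f b, ← cfc_neg, ← cfc_mul _ _ b]
    refine cfc_nonneg fun t _ => ?_
    simp only [f]
    split_ifs with h
    · simp
    · simpa using h

lemma norm_apply_le_of_re_inner_nonpos {e : H →L[ℂ] H} (he : IsStarProjection e) {η ζ : H}
    (h : (⟪e ζ, η⟫_ℂ).re ≤ 0) : ‖e η‖ ≤ 2 * ‖ζ - (2⁻¹ : ℂ) • η‖ := by
  set r := ζ - (2⁻¹ : ℂ) • η with hr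
  have hζ : ζ = (2⁻¹ : ℂ) • η + r := by simp [hr]
  have hsym (u v : H) : ⟪e u, v⟫_ℂ = ⟪u, e v⟫_ℂ := by
    rw [← ContinuousLinearMap.adjoint_inner_left, ← ContinuousLinearMap.star_eq_adjoint,
      he.isSelfAdjoint.star_eq]
  have hidem (u : H) : e (e u) = e u := DFunLike.congr_fun he.isIdempotentElem.eq u
  have hη : (⟪η, e η⟫_ℂ).re = ‖e η‖ ^ 2 := by
    rw [← hidem, ← hsym, hidem]
    exact inner_self_eq_norm_sq (𝕜 := ℂ) (e η)
  have h1 : (2⁻¹ : ℝ) * ‖e η‖ ^ 2 + (⟪r, e η⟫_ℂ).re ≤ 0 := by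
    rw [hsym, hζ, inner_add_left, inner_smul_left, Complex.add_re] at h
    have h2 : (starRingEnd ℂ) 2⁻¹ = ((2⁻¹ : ℝ) : ℂ) := by
      rw [← Complex.conj_ofReal]; simp
    rwa [h2, Complex.re_ofReal_mul, hη] at h
  have h3 : |(⟪r, e η⟫_ℂ).re| ≤ ‖r‖ * ‖e η‖ :=
    (Complex.abs_re_le_norm _).trans (norm_inner_le_norm _ _)
  have h4 := neg_le_of_abs_le h3
  rcases (norm_nonneg (e η)).eq_or_lt with h0 | h0
  · rw [← h0]; positivity
  · nlinarith

end ContinuousLinearMap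

/-- Let `H` be a complex Hilbert space and let `S` be a norm-closed unital
*-subalgebra of `B(H)` which, as a unital C*-algebra, has real rank zero (expressed here
elementwise: every self-adjoint element of `S` can be approximated in norm by self-adjoint
elements of `S` invertible within `S`).  Let `p` be a projection in the double commutant
`S''`.  Then `p` is a strong-operator limit of projections in `S`: for every `ε > 0` and
finitely many vectors `ξ₁, …, ξ_m ∈ H` there is a projection `q ∈ S` with
`‖q ξᵢ − p ξᵢ‖ < ε` for all `i`. -/
theorem projection_in_double_commutant_strong_limit
    {H : Type*} [NormedAddCommGroup H] [InnerProductSpace ℂ H] [CompleteSpace H]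
    (S : StarSubalgebra ℂ (H →L[ℂ] H)) (hclosed : IsClosed (S : Set (H →L[ℂ] H)))
    (hrr0 : ∀ a ∈ S, IsSelfAdjoint a → ∀ ε : ℝ, 0 < ε →
      ∃ b ∈ S, IsSelfAdjoint b ∧ (∃ c ∈ S, b * c = 1 ∧ c * b = 1) ∧ ‖a - b‖ < ε)
    (p : H →L[ℂ] H)
    (hp : p ∈ Set.centralizer (Set.centralizer (S : Set (H →L[ℂ] H))))
    (hproj : star p = p ∧ p * p = p)
    (ε : ℝ) (hε : 0 < ε) (m : ℕ) (ξ : Fin m → H) :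
    ∃ q ∈ S, (star q = q ∧ q * q = q) ∧ ∀ i, ‖q (ξ i) - p (ξ i)‖ < ε := by
  have hpsa : IsSelfAdjoint p := hproj.1
  obtain ⟨M, hM⟩ : ∃ M : ℝ, ∀ i, ‖Sum.elim (fun i => p (ξ i)) (fun i => ξ i - p (ξ i)) i‖ ≤ M := by
    obtain ⟨M, hM⟩ := (Set.finite_range fun i =>
      ‖Sum.elim (fun i => p (ξ i)) (fun i => ξ i - p (ξ i)) i‖).bddAbove
    exact ⟨M, fun i => hM ⟨i, rfl⟩⟩
  set η := Sum.elim (fun i => p (ξ i)) (fun i => ξ i - p (ξ i)) with hη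
  obtain ⟨a, haS, ha, hap⟩ := ContinuousLinearMap.exists_isSelfAdjoint_norm_apply_sub_lt S hp hpsa η
    (ε := ε / 8) (by positivity)
  have hhalf : IsSelfAdjoint ((2⁻¹ : ℂ) • (1 : H →L[ℂ] H)) := by
    rw [IsSelfAdjoint, star_smul]; simp
  obtain ⟨b, hbS, hb, ⟨c, -, hbc, hcb⟩, hab⟩ := hrr0 (a - (2⁻¹ : ℂ) • 1)
    (sub_mem haS (SMulMemClass.smul_mem _ (one_mem S))) (ha.sub hhalf)
    (ε / (8 * (|M| + 1))) (by positivity)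
  obtain ⟨q, hqS, hq, hqb, hqb'⟩ := ContinuousLinearMap.exists_positive_spectral_projection S
    hclosed hbS hb ⟨⟨b, c, hbc, hcb⟩, rfl⟩
  have hbη (i) : ‖b (η i) - (p (η i) - (2⁻¹ : ℂ) • η i)‖ < ε / 4 := by
    have h1 : ‖(a - (2⁻¹ : ℂ) • 1 - b) (η i)‖ ≤ ε / 8 := by
      calc _ ≤ ‖a - (2⁻¹ : ℂ) • 1 - b‖ * ‖η i‖ := ContinuousLinearMap.le_opNorm _ _
        _ ≤ ε / (8 * (|M| + 1)) * (|M| + 1) := by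
          gcongr
          linarith [hM i, le_abs_self M]
        _ = ε / 8 := by field_simp
    have h2 : b (η i) - (p (η i) - (2⁻¹ : ℂ) • η i) =
        (a (η i) - p (η i)) - (a - (2⁻¹ : ℂ) • 1 - b) (η i) := by
      simp; abel
    rw [h2]
    linarith [norm_sub_le (a (η i) - p (η i)) ((a - (2⁻¹ : ℂ) • 1 - b) (η i)), hap i]
  have hpp (u : H) : p (p u) = p u := DFunLike.congr_fun hproj.2 u
  refine ⟨q, hqS, ⟨hq.isSelfAdjoint.star_eq, hq.isIdempotentElem.eq⟩, fun i => ?_⟩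
  have hleft : ‖(1 - q) (p (ξ i))‖ < ε / 2 := by
    have h := hbη (.inl i)
    simp only [hη, Sum.elim_inl, hpp] at h
    have h2 := ContinuousLinearMap.norm_apply_le_of_re_inner_nonpos hq.one_sub
      (η := p (ξ i)) (ζ := b (p (ξ i))) (by
        have := ((ContinuousLinearMap.nonneg_iff_isPositive _).1 hqb').re_inner_nonneg_left
          (p (ξ i))
        simpa [inner_sub_left] using this)
    have h3 : p (ξ i) - (2⁻¹ : ℂ) • p (ξ i) = (2⁻¹ : ℂ) • p (ξ i) := by module
    rw [h3] at h
    linarith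
  have hright : ‖q (ξ i - p (ξ i))‖ < ε / 2 := by
    have h := hbη (.inr i)
    simp only [hη, Sum.elim_inr, map_sub p, hpp, sub_self, zero_sub] at h
    have h2 := ContinuousLinearMap.norm_apply_le_of_re_inner_nonpos hq
      (η := ξ i - p (ξ i)) (ζ := -b (ξ i - p (ξ i))) (by
        have := ((ContinuousLinearMap.nonneg_iff_isPositive _).1 hqb).re_inner_nonneg_left
          (ξ i - p (ξ i))
        rw [map_neg q, inner_neg_left, Complex.neg_re, neg_nonpos]
        exact this)
    rw [← norm_neg] at h
    have h3 : -(b (ξ i - p (ξ i)) - -((2⁻¹ : ℂ) • (ξ i - p (ξ i)))) =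
      -b (ξ i - p (ξ i)) - (2⁻¹ : ℂ) • (ξ i - p (ξ i)) := by module
    rw [h3] at h
    linarith
  have h : q (ξ i) - p (ξ i) = q (ξ i - p (ξ i)) - (1 - q) (p (ξ i)) := by simp
  rw [h]
  linarith [norm_sub_le (q (ξ i - p (ξ i))) ((1 - q) (p (ξ i)))]
end
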